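/- Liouville theorem in the half-space for the fractional Laplacian (Corollary 1.4, classical-supersolution form). Let N ≥ 2, α ∈ (0,1), and let p ∈ ℝ satisfy −1 ≤ p ≤ (N+α)/(N−α). Let H = {x ∈ ℝ^N : x_N > 0}. Then there is no continuous function u : ℝ^N → ℝ with u(x) > 0 for all x ∈ H and u(x) ≥ 0 for all x ∈ ℝ^N ∖ H, such that for every x ∈ H the function y ↦ δ(u,x,y) |y|^{−(N+2α)} is Lebesgue integrable on ℝ^N and ∫_{ℝ^N} δ(u,x,y) |y|^{−(N+2α)} dy + u(x)^p ≤ 0. -/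

import Mathlib

open MeasureTheory

/-- The nonlocal second difference `δ(u,x,y) = u(x+y) + u(x-y) - 2u(x)`. -/
noncomputable def nlD {N : ℕ} (u : EuclideanSpace ℝ (Fin N) → ℝ)
    (x y : EuclideanSpace ℝ (Fin N)) : ℝ :=
  u (x + y) + u (x - y) - 2 * u x

set_option linter.unusedVariables false
set_option linter.unusedSectionVars false

section
open Set Filter Topology Metric

/-- positive-part power -/
noncomputable def pp (β a : ℝ) : ℝ := (max a 0) ^ β

noncomputable def GG (β t : ℝ) : ℝ := pp β (1 + t) + pp β (1 - t) - 2

lemma pp_nonneg (β a : ℝ) : 0 ≤ pp β a := Real.rpow_nonneg (le_max_right _ _) _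

lemma pp_of_pos {β a : ℝ} (h : 0 ≤ a) : pp β a = a ^ β := by simp [pp, max_eq_left h]

lemma pp_of_neg {β a : ℝ} (hβ : 0 < β) (h : a ≤ 0) : pp β a = 0 := by
  simp [pp, max_eq_right h, Real.zero_rpow hβ.ne']

lemma pp_mono {β : ℝ} (hβ : 0 < β) : Monotone (pp β) := fun a b h => by
  unfold pp
  exact Real.rpow_le_rpow (le_max_right _ _) (max_le_max_right 0 h) hβ.le

lemma pp_cont {β : ℝ} (hβ : 0 < β) : Continuous (pp β) := by
  unfold pp
  exact (continuous_id.max continuous_const).rpow_const (fun _ => Or.inr hβ.le)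

lemma pp_scale {β s a : ℝ} (hs : 0 < s) : pp β (s * a) = s ^ β * pp β a := by
  unfold pp
  rw [← Real.mul_rpow hs.le (le_max_right _ _), mul_max_of_nonneg _ _ hs.le, mul_zero]

/-- subadditivity -/
lemma pp_sub_le {β a b : ℝ} (hβ : 0 < β) (hβ1 : β ≤ 1) (hb : 0 ≤ b) :
    pp β a - pp β (a - b) ≤ b ^ β := by
  rcases le_or_gt a b with h | h
  · have : pp β a ≤ b ^ β := by
      rw [← pp_of_pos hb]; exact pp_mono hβ h
    linarith [pp_nonneg β (a - b)]
  · rw [pp_of_pos (by linarith), pp_of_pos (by linarith)]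
    have := Real.rpow_add_le_add_rpow (p := β) (show 0 ≤ a - b by linarith) hb hβ.le hβ1
    simp only [sub_add_cancel] at this
    linarith

lemma pp_sub_le' {β a b : ℝ} (hβ : 0 < β) (hβ1 : β ≤ 1) (hb : 0 ≤ b) (hab : b ≤ a) (ha : 0 < a) :
    pp β a - pp β (a - b) ≤ b * a ^ (β - 1) := by
  rw [pp_of_pos (by linarith), pp_of_pos (by linarith)]
  have h1 : (1 - b / a) ≤ (1 - b / a) ^ β := by
    have h0 : 0 ≤ 1 - b / a := by rw [sub_nonneg, div_le_one ha]; exact hab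
    have h2 : 1 - b / a ≤ 1 := by have := div_nonneg hb ha.le; linarith
    rcases h0.eq_or_lt with h | h
    · rw [← h]; positivity
    · nth_rewrite 1 [← Real.rpow_one (1 - b / a)]
      exact Real.rpow_le_rpow_of_exponent_ge h h2 hβ1
  have h3 : a - b = a * (1 - b / a) := by field_simp
  rw [h3, Real.mul_rpow ha.le (by rw [sub_nonneg, div_le_one ha]; exact hab), Real.rpow_sub_one ha.ne']
  have : 0 ≤ a ^ β := by positivity
  have := mul_le_mul_of_nonneg_left h1 this
  calc a ^ β - a ^ β * (1 - b / a) ^ β ≤ a ^ β - a ^ β * (1 - b / a) := by linarith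
    _ = b * (a ^ β / a) := by field_simp; ring

lemma GG_even (β t : ℝ) : GG β (-t) = GG β t := by unfold GG; ring_nf

lemma GG_cont {β : ℝ} (hβ : 0 < β) : Continuous (GG β) := by
  have := pp_cont hβ
  unfold GG; fun_prop

lemma GG_abs_small {β t : ℝ} (hβ : 0 < β) (hβ1 : β ≤ 1) (ht : |t| ≤ 1) : |GG β t| ≤ 2 * t ^ 2 := by
  rw [abs_le] at ht
  have h1 : 0 ≤ 1 + t := by linarith
  have h2 : 0 ≤ 1 - t := by linarith
  unfold GG
  rw [pp_of_pos h1, pp_of_pos h2, abs_le]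
  constructor
  · set x := (1 + t) ^ β with hx
    set y := (1 - t) ^ β with hy
    have hx0 : 0 ≤ x := by positivity
    have hy0 : 0 ≤ y := by positivity
    have hxy : x * y = (1 - t ^ 2) ^ β := by
      rw [hx, hy, ← Real.mul_rpow h1 h2]; ring_nf
    have h0 : 0 ≤ 1 - t ^ 2 := by nlinarith
    have h3 : (1 - t ^ 2) ≤ (1 - t ^ 2) ^ β := by
      rcases h0.eq_or_lt with h | h
      · rw [← h]; positivity
      · nth_rewrite 1 [← Real.rpow_one (1 - t ^ 2)]
        exact Real.rpow_le_rpow_of_exponent_ge h (by nlinarith) hβ1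
    rw [← hxy] at h3
    by_contra hc
    push Not at hc
    nlinarith [sq_nonneg (x - y), sq_nonneg t]
  · have h3 := rpow_one_add_le_one_add_mul_self (s := t) (p := β) (by linarith) hβ.le hβ1
    have h4 := rpow_one_add_le_one_add_mul_self (s := -t) (p := β) (by linarith) hβ.le hβ1
    have : (1 - t) = 1 + -t := by ring
    rw [this]
    nlinarith [sq_nonneg t]

lemma GG_nonpos {β t : ℝ} (hβ : 0 < β) (hβ1 : β ≤ 1) (ht : |t| ≤ 1) : GG β t ≤ 0 := by
  rw [abs_le] at ht
  unfold GG
  rw [pp_of_pos (by linarith), pp_of_pos (by linarith)]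
  have h3 := rpow_one_add_le_one_add_mul_self (s := t) (p := β) (by linarith) hβ.le hβ1
  have h4 := rpow_one_add_le_one_add_mul_self (s := -t) (p := β) (by linarith) hβ.le hβ1
  have : (1 - t) = 1 + -t := by ring
  rw [this]
  linarith

lemma GG_abs_large {β t : ℝ} (hβ : 0 < β) (hβ1 : β ≤ 1) (ht : 1 ≤ |t|) : |GG β t| ≤ 2 * |t| ^ β := by
  wlog h : 0 ≤ t generalizing t
  · have := this (t := -t) (by simpa using ht) (by linarith)
    simpa [GG_even] using this
  rw [abs_of_nonneg h] at ht
  unfold GG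
  rw [pp_of_pos (by linarith), pp_of_neg hβ (by linarith), abs_of_nonneg h]
  have h1 := Real.rpow_add_le_add_rpow (p := β) (show (0:ℝ) ≤ 1 by norm_num) h hβ.le hβ1
  have h2 : 1 ≤ t ^ β := Real.one_le_rpow ht hβ.le
  have h3 : 0 ≤ (1 + t) ^ β := by positivity
  rw [Real.one_rpow] at h1
  rw [abs_le]; constructor <;> linarith

lemma GG_abs_sq {β t : ℝ} (hβ : 0 < β) (hβ1 : β ≤ 1) : |GG β t| ≤ 2 * t ^ 2 := by
  rcases le_or_gt |t| 1 with h | h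
  · exact GG_abs_small hβ hβ1 h
  · refine (GG_abs_large hβ hβ1 h.le).trans ?_
    have : |t| ^ β ≤ |t| ^ (2:ℝ) := Real.rpow_le_rpow_of_exponent_le h.le (by linarith)
    rw [Real.rpow_two, sq_abs] at this
    linarith

lemma GG_abs_pow {β t : ℝ} (hβ : 0 < β) (hβ1 : β ≤ 1) : |GG β t| ≤ 2 * |t| ^ β := by
  rcases le_or_gt |t| 1 with h | h
  · refine (GG_abs_small hβ hβ1 h).trans ?_
    rcases (abs_nonneg t).eq_or_lt with h0 | h0
    · rw [← h0, Real.zero_rpow hβ.ne']; have : t = 0 := abs_eq_zero.1 h0.symm; simp [this]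
    have : |t| ^ (2:ℝ) ≤ |t| ^ β := Real.rpow_le_rpow_of_exponent_ge h0 h (by linarith)
    rw [Real.rpow_two, sq_abs] at this
    linarith
  · exact GG_abs_large hβ hβ1 h.le

/-- integrability of the one-dimensional profile -/
lemma GG_integrable {α β : ℝ} (hα : α < 1) (hβ : 0 < β) (hβ1 : β ≤ 1) (hβα : β < 2 * α) :
    IntegrableOn (fun t => GG β t * t ^ (-1 - 2 * α)) (Ioi 0) := by
  rw [← Ioc_union_Ioi_eq_Ioi (zero_le_one (α := ℝ))]
  have hm : Measurable (fun t => GG β t * t ^ (-1 - 2 * α)) :=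
    (GG_cont hβ).measurable.mul (by fun_prop)
  refine IntegrableOn.union ?_ ?_
  · have : IntegrableOn (fun t : ℝ => 2 * t ^ (1 - 2 * α)) (Ioc 0 1) := by
      refine Integrable.const_mul ?_ _
      rw [← IntegrableOn, ← intervalIntegrable_iff_integrableOn_Ioc_of_le zero_le_one]
      exact intervalIntegral.intervalIntegrable_rpow' (by linarith)
    refine Integrable.mono' this hm.aestronglyMeasurable ?_
    refine (ae_restrict_mem measurableSet_Ioc).mono fun t ht => ?_
    rw [norm_mul, Real.norm_eq_abs, Real.norm_eq_abs, abs_of_nonneg (Real.rpow_nonneg ht.1.le _)]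
    have h1 : t ^ (1 - 2 * α) = t ^ 2 * t ^ (-1 - 2 * α) := by
      rw [← Real.rpow_two, ← Real.rpow_add ht.1]; ring_nf
    rw [h1, ← mul_assoc]
    exact mul_le_mul_of_nonneg_right (GG_abs_sq hβ hβ1) (Real.rpow_nonneg ht.1.le _)
  · have : IntegrableOn (fun t : ℝ => 2 * t ^ (β - 1 - 2 * α)) (Ioi 1) := by
      refine Integrable.const_mul ?_ _
      exact integrableOn_Ioi_rpow_of_lt (by linarith) one_pos
    refine Integrable.mono' this hm.aestronglyMeasurable ?_
    refine (ae_restrict_mem measurableSet_Ioi).mono fun t ht => ?_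
    have ht0 : 0 < t := one_pos.trans ht
    rw [norm_mul, Real.norm_eq_abs, Real.norm_eq_abs, abs_of_nonneg (Real.rpow_nonneg ht0.le _)]
    have h1 : t ^ (β - 1 - 2 * α) = t ^ β * t ^ (-1 - 2 * α) := by
      rw [← Real.rpow_add ht0]; ring_nf
    rw [h1, ← mul_assoc]
    refine mul_le_mul_of_nonneg_right ?_ (Real.rpow_nonneg ht0.le _)
    have := GG_abs_pow (t := t) hβ hβ1
    rwa [abs_of_pos ht0] at this

noncomputable def cB (α β : ℝ) : ℝ := ∫ t in Ioi (0:ℝ), GG β t * t ^ (-1 - 2 * α)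

noncomputable def WW (α β x : ℝ) : ℝ :=
  x ^ (-1 - 2 * α) * (((1 - x) ^ (-β) - 1) * (1 - x) ^ (2 * α - 1) + ((1 - x) ^ β - 1))

noncomputable def FF (α x : ℝ) : ℝ := x ^ (-(2 * α)) * (1 - (1 - x) ^ α) ^ 2 / (2 * α)

lemma FF_deriv {α x : ℝ} (hα : 0 < α) (hx : x ∈ Ioo (0:ℝ) 1) :
    HasDerivAt (FF α) (WW α α x) x := by
  have hx0 := hx.1
  have hx1 : 0 < 1 - x := by linarith [hx.2]
  have h1 : HasDerivAt (fun x : ℝ => x ^ (-(2 * α))) (-(2 * α) * x ^ (-(2 * α) - 1)) x :=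
    Real.hasDerivAt_rpow_const (Or.inl hx0.ne')
  have h2 : HasDerivAt (fun x : ℝ => 1 - x) (-1) x := by
    simpa using (hasDerivAt_id x).const_sub 1
  have h3 : HasDerivAt (fun x : ℝ => (1 - x) ^ α) (-1 * α * (1 - x) ^ (α - 1)) x :=
    h2.rpow_const (Or.inl hx1.ne')
  have h4 := ((h1.mul ((h3.const_sub 1).pow 2)).div_const (2 * α))
  refine h4.congr_deriv ?_
  unfold WW
  have e1 : x ^ (-(2 * α)) = x * x ^ (-1 - 2 * α) := by
    nth_rewrite 2 [← Real.rpow_one x]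
    rw [← Real.rpow_add hx0]; ring_nf
  have e2 : x ^ (-(2 * α) - 1) = x ^ (-1 - 2 * α) := by ring_nf
  have e3 : (1 - x) ^ (α - 1) = (1 - x) ^ α / (1 - x) := Real.rpow_sub_one hx1.ne' _
  have e4 : (1 - x) ^ (-α) = ((1 - x) ^ α)⁻¹ := Real.rpow_neg hx1.le _
  have e5 : (1 - x) ^ (2 * α - 1) = ((1 - x) ^ α) ^ 2 / (1 - x) := by
    rw [Real.rpow_sub_one hx1.ne', mul_comm 2 α, Real.rpow_mul hx1.le, Real.rpow_two]
  have hA : 0 < (1 - x) ^ α := by positivity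
  rw [e1, e2, e3, e4, e5]
  simp only [Pi.pow_apply]
  field_simp
  ring

lemma FF_cont {α ε : ℝ} (hα : 0 < α) (hε : 0 < ε) : ContinuousOn (FF α) (Icc ε 1) := by
  unfold FF
  refine ContinuousOn.div_const (ContinuousOn.mul ?_ ?_) _
  · exact continuousOn_id.rpow_const fun x hx => Or.inl (by simp only [id]; linarith [hx.1])
  · refine ContinuousOn.pow (continuousOn_const.sub ?_) 2
    exact (continuousOn_const.sub continuousOn_id).rpow_const fun x hx => Or.inr hα.le

lemma WW_sub {α β x : ℝ} (hx : x ∈ Ioo (0:ℝ) 1) :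
    WW α β x - WW α α x = x ^ (-1 - 2 * α) *
      ((1 - (1 - x) ^ (β - α)) * ((1 - x) ^ (2 * α - 1 - β) - (1 - x) ^ α)) := by
  have hx1 : 0 < 1 - x := by linarith [hx.2]
  unfold WW
  rw [← mul_sub]
  congr 1
  set X := 1 - x
  have e1 : X ^ (2 * α - 1 - β) = X ^ (2 * α - 1) / X ^ β := Real.rpow_sub hx1 _ _
  have e2 : X ^ (β - α) = X ^ β / X ^ α := Real.rpow_sub hx1 _ _
  have hA : 0 < X ^ α := by positivity
  have hB : 0 < X ^ β := by positivity
  rw [e1, e2, Real.rpow_neg hx1.le, Real.rpow_neg hx1.le]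
  field_simp
  ring

lemma WW_sub_pos {α β x : ℝ} (hα : 0 < α) (h : α < β) (hx : x ∈ Ioo (0:ℝ) 1) :
    0 < WW α β x - WW α α x := by
  rw [WW_sub hx]
  have hx0 := hx.1
  have hx1 : 0 < 1 - x := by linarith [hx.2]
  have hx2 : 1 - x < 1 := by linarith
  refine mul_pos (by positivity) (mul_pos ?_ ?_)
  · have := Real.rpow_lt_one hx1.le hx2 (show 0 < β - α by linarith); linarith
  · have := Real.rpow_lt_rpow_of_exponent_gt hx1 hx2 (show 2 * α - 1 - β < α by linarith); linarith

lemma WW_mono {α β x : ℝ} (hα : 0 < α) (h : α ≤ β) (hx : x ∈ Ioo (0:ℝ) 1) :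
    0 ≤ WW α β x - WW α α x := by
  rcases h.eq_or_lt with h | h
  · rw [h]; simp
  · exact (WW_sub_pos hα h hx).le

lemma WW_alpha_nonneg {α x : ℝ} (hα : 0 < α) (hα1 : α < 1) (hx : x ∈ Ioo (0:ℝ) 1) : 0 ≤ WW α α x := by
  have hx0 := hx.1
  have hx1 : 0 < 1 - x := by linarith [hx.2]
  have hx2 : 1 - x < 1 := by linarith
  have : WW α α x = x ^ (-1 - 2 * α) * ((1 - (1 - x) ^ α) * ((1 - x) ^ (α - 1) - 1)) := by
    unfold WW
    have e3 : (1 - x) ^ (α - 1) = (1 - x) ^ α / (1 - x) := Real.rpow_sub_one hx1.ne' _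
    have e4 : (1 - x) ^ (-α) = ((1 - x) ^ α)⁻¹ := Real.rpow_neg hx1.le _
    have e5 : (1 - x) ^ (2 * α - 1) = ((1 - x) ^ α) ^ 2 / (1 - x) := by
      rw [Real.rpow_sub_one hx1.ne', mul_comm 2 α, Real.rpow_mul hx1.le, Real.rpow_two]
    have hA : 0 < (1 - x) ^ α := by positivity
    rw [e3, e4, e5]
    field_simp
    ring
  rw [this]
  refine mul_nonneg (by positivity) (mul_nonneg ?_ ?_)
  · have := Real.rpow_le_one hx1.le hx2.le hα.le; linarith
  · have := Real.one_le_rpow_of_pos_of_le_one_of_nonpos hx1 hx2.le (show α - 1 ≤ 0 by linarith); linarith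

lemma WW_alpha_int {α ε : ℝ} (hα : 0 < α) (hα1 : α < 1) (hε : 0 < ε) (hε1 : ε < 1) :
    IntegrableOn (WW α α) (Ioo ε 1) ∧ ∫ x in Ioo ε 1, WW α α x = 1 / (2 * α) - FF α ε := by
  have hd : ∀ x ∈ Ioo ε 1, HasDerivAt (FF α) (WW α α x) x :=
    fun x hx => FF_deriv hα ⟨hε.trans hx.1, hx.2⟩
  have hi : IntegrableOn (WW α α) (Ioc ε 1) :=
    intervalIntegral.integrableOn_deriv_of_nonneg (FF_cont hα hε) hd
      (fun x hx => WW_alpha_nonneg hα hα1 ⟨hε.trans hx.1, hx.2⟩)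
  refine ⟨hi.mono_set Ioo_subset_Ioc_self, ?_⟩
  rw [← integral_Ioc_eq_integral_Ioo, ← intervalIntegral.integral_of_le hε1.le,
    intervalIntegral.integral_eq_sub_of_hasDerivAt_of_le hε1.le (FF_cont hα hε) hd
      ((intervalIntegrable_iff_integrableOn_Ioc_of_le hε1.le).2 hi)]
  simp [FF, Real.zero_rpow hα.ne']

lemma FF_small {α ε : ℝ} (hα : 0 < α) (hα1 : α < 1) (hε : 0 < ε) (hε1 : ε < 1) :
    FF α ε ≤ ε ^ (2 - 2 * α) / (2 * α) := by
  unfold FF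
  have h1 : 0 < 1 - ε := by linarith
  have h2 : (1 - ε) ≤ (1 - ε) ^ α := by
    nth_rewrite 1 [← Real.rpow_one (1 - ε)]
    exact Real.rpow_le_rpow_of_exponent_ge h1 (by linarith) hα1.le
  have h3 := Real.rpow_le_one h1.le (by linarith) hα.le
  have h4 : (1 - (1 - ε) ^ α) ^ 2 ≤ ε ^ 2 := by
    apply pow_le_pow_left₀ <;> linarith
  have h5 : ε ^ (2 - 2 * α) = ε ^ (-(2 * α)) * ε ^ 2 := by
    rw [← Real.rpow_two, ← Real.rpow_add hε]; ring_nf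
  rw [h5]
  gcongr

lemma first_piece {α β ε : ℝ} (hα : 0 < α) (hβ : 0 < β) (hβ1 : β ≤ 1) (hβα : β < 2 * α)
    (hε : 0 < ε) (hε1 : ε < 1) :
    IntegrableOn (fun t : ℝ => ((1 + t) ^ β - 1) * t ^ (-1 - 2 * α)) (Ioi ε) ∧
    IntegrableOn (fun x : ℝ => x ^ (-1 - 2 * α) * (((1 - x) ^ (-β) - 1) * (1 - x) ^ (2 * α - 1)))
      (Ioo ε 1) ∧
    ∫ x in Ioo ε 1, x ^ (-1 - 2 * α) * (((1 - x) ^ (-β) - 1) * (1 - x) ^ (2 * α - 1)) ≤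
      ∫ t in Ioi ε, ((1 + t) ^ β - 1) * t ^ (-1 - 2 * α) := by
  have hI : IntegrableOn (fun t : ℝ => ((1 + t) ^ β - 1) * t ^ (-1 - 2 * α)) (Ioi ε) := by
    have : IntegrableOn (fun t : ℝ => t ^ (β - 1 - 2 * α)) (Ioi ε) :=
      integrableOn_Ioi_rpow_of_lt (by linarith) hε
    refine Integrable.mono' this ?_ ?_
    · refine Measurable.aestronglyMeasurable ?_; fun_prop
    refine (ae_restrict_mem measurableSet_Ioi).mono fun t ht => ?_
    have ht0 : 0 < t := hε.trans ht
    have h1 : t ^ (β - 1 - 2 * α) = t ^ β * t ^ (-1 - 2 * α) := by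
      rw [← Real.rpow_add ht0]; ring_nf
    have h2 := Real.rpow_add_le_add_rpow (p := β) (show (0:ℝ) ≤ 1 by norm_num) ht0.le hβ.le hβ1
    rw [Real.one_rpow] at h2
    have h3 : 1 ≤ (1 + t) ^ β := Real.one_le_rpow (by linarith) hβ.le
    rw [norm_mul, Real.norm_eq_abs, Real.norm_eq_abs, abs_of_nonneg (Real.rpow_nonneg ht0.le _),
      abs_of_nonneg (by linarith), h1]
    exact mul_le_mul_of_nonneg_right (by linarith) (Real.rpow_nonneg ht0.le _)
  set f : ℝ → ℝ := fun x => x / (1 - x) with hf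
  have hsub : f '' Ioo ε 1 ⊆ Ioi ε := by
    rintro _ ⟨x, hx, rfl⟩
    have : 0 < 1 - x := by linarith [hx.2]
    simp only [hf, mem_Ioi]
    rw [lt_div_iff₀ this]
    nlinarith [hx.1, hx.2]
  have hder : ∀ x ∈ Ioo ε 1, HasDerivWithinAt f (((1 - x) ^ 2)⁻¹) (Ioo ε 1) x := by
    intro x hx
    have h1 : 0 < 1 - x := by linarith [hx.2]
    have h2 : HasDerivAt (fun x : ℝ => 1 - x) (-1) x := by
      simpa using (hasDerivAt_id x).const_sub 1
    have := ((hasDerivAt_id x).div h2 h1.ne')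
    refine (this.congr_deriv ?_).hasDerivWithinAt
    simp
  have hinj : InjOn f (Ioo ε 1) := by
    intro x hx y hy hxy
    have h1 : 1 - x ≠ 0 := by linarith [hx.2]
    have h2 : 1 - y ≠ 0 := by linarith [hy.2]
    simp only [hf] at hxy
    rw [div_eq_div_iff h1 h2] at hxy
    linarith
  have heq : ∀ x ∈ Ioo ε 1, |((1 - x) ^ 2)⁻¹| • (((1 + f x) ^ β - 1) * (f x) ^ (-1 - 2 * α)) =
      x ^ (-1 - 2 * α) * (((1 - x) ^ (-β) - 1) * (1 - x) ^ (2 * α - 1)) := by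
    intro x hx
    have h1 : 0 < 1 - x := by linarith [hx.2]
    have h0 : 0 < x := hε.trans hx.1
    have e1 : 1 + f x = (1 - x)⁻¹ := by simp only [hf]; field_simp; ring
    rw [e1, abs_of_pos (by positivity)]
    simp only [hf, smul_eq_mul]
    rw [Real.div_rpow h0.le h1.le, Real.inv_rpow h1.le, Real.rpow_neg h1.le]
    have e2 : (1 - x) ^ (2 * α - 1) = (((1 - x) ^ 2)⁻¹) * ((1 - x) ^ (-1 - 2 * α))⁻¹ := by
      rw [← Real.rpow_two, ← Real.rpow_neg h1.le, ← Real.rpow_neg h1.le, ← Real.rpow_add h1]; ring_nf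
    rw [e2]; ring
  have hIi := hI.mono_set hsub
  refine ⟨hI, ?_, ?_⟩
  · have := (integrableOn_image_iff_integrableOn_abs_deriv_smul measurableSet_Ioo hder hinj _).1 hIi
    exact this.congr_fun heq measurableSet_Ioo
  · rw [← setIntegral_congr_fun measurableSet_Ioo heq,
      ← integral_image_eq_integral_abs_deriv_smul measurableSet_Ioo hder hinj
        (fun t : ℝ => ((1 + t) ^ β - 1) * t ^ (-1 - 2 * α))]
    refine setIntegral_mono_set hI ?_ (LE.le.eventuallyLE hsub)
    refine (ae_restrict_mem measurableSet_Ioi).mono fun t ht => ?_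
    have ht0 : 0 < t := hε.trans ht
    have h3 : 1 ≤ (1 + t) ^ β := Real.one_le_rpow (by linarith) hβ.le
    exact mul_nonneg (by linarith) (Real.rpow_nonneg ht0.le _)

lemma trunc_lower {α β ε : ℝ} (hα : 0 < α) (hα1 : α < 1) (hβ : α ≤ β) (hβ1 : β ≤ 1) (hβα : β < 2 * α)
    (hε : 0 < ε) (hε1 : ε < 1 / 2) :
    IntegrableOn (fun x => WW α β x - WW α α x) (Ioo (1/2) 1) ∧
    (∫ x in Ioo (1/2) 1, (WW α β x - WW α α x)) - ε ^ (2 - 2 * α) / (2 * α) ≤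
      ∫ t in Ioi ε, GG β t * t ^ (-1 - 2 * α) := by
  have hβ0 : 0 < β := hα.trans_le hβ
  have hε2 : ε < 1 := by linarith
  obtain ⟨p1, p2, p3⟩ := first_piece hα hβ0 hβ1 hβα hε hε2
  have q1 : IntegrableOn (fun x : ℝ => x ^ (-1 - 2 * α) * ((1 - x) ^ β - 1)) (Ioo ε 1) := by
    have hc : ContinuousOn (fun x : ℝ => x ^ (-1 - 2 * α) * ((1 - x) ^ β - 1)) (Icc ε 1) := by
      refine ContinuousOn.mul ?_ ?_
      · exact continuousOn_id.rpow_const fun x hx => Or.inl (by simp only [id]; linarith [hx.1])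
      · refine ContinuousOn.sub ?_ continuousOn_const
        exact (continuousOn_const.sub continuousOn_id).rpow_const fun x hx => Or.inr hβ0.le
    exact (hc.integrableOn_Icc).mono_set Ioo_subset_Icc_self
  have hW : IntegrableOn (WW α β) (Ioo ε 1) := by
    have := p2.add q1
    refine this.congr_fun (fun x hx => ?_) measurableSet_Ioo
    simp only [WW, Pi.add_apply]; ring
  have hWi : ∫ x in Ioo ε 1, WW α β x =
      (∫ x in Ioo ε 1, x ^ (-1 - 2 * α) * (((1 - x) ^ (-β) - 1) * (1 - x) ^ (2 * α - 1))) +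
      ∫ x in Ioo ε 1, x ^ (-1 - 2 * α) * ((1 - x) ^ β - 1) := by
    rw [← integral_add p2 q1]
    refine setIntegral_congr_fun measurableSet_Ioo (fun x hx => ?_)
    simp only [WW]; ring
  obtain ⟨a1, a2⟩ := WW_alpha_int hα hα1 hε hε2
  have hsub : Ioo (1/2:ℝ) 1 ⊆ Ioo ε 1 := Ioo_subset_Ioo_left hε1.le
  have hD : IntegrableOn (fun x => WW α β x - WW α α x) (Ioo ε 1) := hW.sub a1
  refine ⟨hD.mono_set hsub, ?_⟩
  have hmono : (∫ x in Ioo (1/2) 1, (WW α β x - WW α α x)) ≤ ∫ x in Ioo ε 1, (WW α β x - WW α α x) := by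
    refine setIntegral_mono_set hD ?_ (LE.le.eventuallyLE hsub)
    exact (ae_restrict_mem measurableSet_Ioo).mono fun x hx => WW_mono hα hβ ⟨hε.trans hx.1, hx.2⟩
  rw [integral_sub hW a1, a2] at hmono
  have hk : IntegrableOn (fun t : ℝ => t ^ (-1 - 2 * α)) (Ioi 1) :=
    integrableOn_Ioi_rpow_of_lt (by linarith) one_pos
  have hki : ∫ t in Ioi (1:ℝ), t ^ (-1 - 2 * α) = 1 / (2 * α) := by
    rw [integral_Ioi_rpow_of_lt (by linarith) one_pos, Real.one_rpow]
    rw [show -1 - 2 * α + 1 = -(2 * α) by ring, neg_div_neg_eq]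
  have s1 : IntegrableOn (fun t : ℝ => (pp β (1 - t) - 1) * t ^ (-1 - 2 * α)) (Ioc ε 1) := by
    refine ((integrableOn_Ioc_iff_integrableOn_Ioo).2 q1).congr_fun (fun t ht => ?_) measurableSet_Ioc
    simp only [pp_of_pos (show 0 ≤ 1 - t by linarith [ht.2])]; ring
  have s2 : IntegrableOn (fun t : ℝ => (pp β (1 - t) - 1) * t ^ (-1 - 2 * α)) (Ioi 1) := by
    refine hk.neg.congr_fun (fun t ht => ?_) measurableSet_Ioi
    simp only [pp_of_neg hβ0 (show 1 - t ≤ 0 by linarith [mem_Ioi.1 ht]), Pi.neg_apply]; ring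
  have s3 : IntegrableOn (fun t : ℝ => (pp β (1 - t) - 1) * t ^ (-1 - 2 * α)) (Ioi ε) := by
    rw [← Ioc_union_Ioi_eq_Ioi hε2.le]; exact s1.union s2
  have s4 : ∫ t in Ioi ε, (pp β (1 - t) - 1) * t ^ (-1 - 2 * α) =
      (∫ x in Ioo ε 1, x ^ (-1 - 2 * α) * ((1 - x) ^ β - 1)) - 1 / (2 * α) := by
    rw [← Ioc_union_Ioi_eq_Ioi hε2.le, setIntegral_union (Ioc_disjoint_Ioi le_rfl) measurableSet_Ioi s1 s2,
      ← hki, sub_eq_add_neg (∫ x in Ioo ε 1, x ^ (-1 - 2 * α) * ((1 - x) ^ β - 1)), ← integral_neg,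
      ← integral_Ioc_eq_integral_Ioo]
    congr 1
    · refine setIntegral_congr_fun measurableSet_Ioc (fun t ht => ?_)
      simp only [pp_of_pos (show 0 ≤ 1 - t by linarith [ht.2])]; ring
    · refine setIntegral_congr_fun measurableSet_Ioi (fun t ht => ?_)
      simp only [pp_of_neg hβ0 (show 1 - t ≤ 0 by linarith [mem_Ioi.1 ht])]; ring
  have htot : ∫ t in Ioi ε, GG β t * t ^ (-1 - 2 * α) =
      (∫ t in Ioi ε, ((1 + t) ^ β - 1) * t ^ (-1 - 2 * α)) +
      ∫ t in Ioi ε, (pp β (1 - t) - 1) * t ^ (-1 - 2 * α) := by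
    rw [← integral_add p1 s3]
    refine setIntegral_congr_fun measurableSet_Ioi (fun t ht => ?_)
    simp only [GG, pp_of_pos (show 0 ≤ 1 + t by linarith [mem_Ioi.1 ht])]; ring
  rw [htot, s4]
  have := FF_small hα hα1 hε hε2
  linarith

lemma cB_lower {α β : ℝ} (hα : 0 < α) (hα1 : α < 1) (hβ : α ≤ β) (hβ1 : β ≤ 1) (hβα : β < 2 * α) :
    (∫ x in Ioo (1/2) 1, (WW α β x - WW α α x)) ≤ cB α β := by
  have hβ0 : 0 < β := hα.trans_le hβ
  have hI := GG_integrable hα1 hβ0 hβ1 hβα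
  set u : ℕ → ℝ := fun n => 1 / ((n:ℝ) + 3) with hu
  have hu0 : ∀ n, 0 < u n := fun n => by simp only [hu]; positivity
  have hlim : Tendsto u atTop (𝓝 0) := by
    have := tendsto_one_div_add_atTop_nhds_zero_nat (𝕜 := ℝ)
    have h2 := this.comp (tendsto_add_atTop_nat 2)
    refine h2.congr fun n => ?_
    simp only [hu, Function.comp]; push_cast; ring_nf
  have hanti : Antitone u := fun m n h => by
    simp only [hu]; 
    have : (m:ℝ) ≤ n := by exact_mod_cast h
    gcongr
  have hun : ⋃ n, Ioi (u n) = Ioi (0:ℝ) := by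
    ext x; simp only [mem_iUnion, mem_Ioi]
    constructor
    · rintro ⟨n, hn⟩; exact (hu0 n).trans hn
    · intro hx
      exact ((hlim.eventually (gt_mem_nhds hx))).exists
  have ht : Tendsto (fun n => ∫ t in Ioi (u n), GG β t * t ^ (-1 - 2 * α)) atTop (𝓝 (cB α β)) := by
    have := tendsto_setIntegral_of_monotone (μ := volume) (s := fun n => Ioi (u n))
      (f := fun t => GG β t * t ^ (-1 - 2 * α)) (fun n => measurableSet_Ioi)
      (fun m n h => Ioi_subset_Ioi (hanti h)) (by rw [hun]; exact hI)
    rw [hun] at this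
    exact this
  have ht2 : Tendsto (fun n => (∫ x in Ioo (1/2) 1, (WW α β x - WW α α x)) - (u n) ^ (2 - 2 * α) / (2 * α))
      atTop (𝓝 ((∫ x in Ioo (1/2) 1, (WW α β x - WW α α x)) - 0 ^ (2 - 2 * α) / (2 * α))) := by
    refine tendsto_const_nhds.sub (Tendsto.div_const ?_ _)
    exact hlim.rpow_const (Or.inr (by linarith))
  rw [Real.zero_rpow (by linarith), zero_div, sub_zero] at ht2
  refine le_of_tendsto_of_tendsto' ht2 ht fun n => ?_
  refine (trunc_lower hα hα1 hβ hβ1 hβα (hu0 n) ?_).2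
  simp only [hu]
  rw [div_lt_div_iff₀ (by positivity) (by norm_num)]
  have : (0:ℝ) ≤ n := by positivity
  linarith

lemma cB_nonneg {α : ℝ} (hα : 0 < α) (hα1 : α < 1) : 0 ≤ cB α α := by
  have := cB_lower hα hα1 le_rfl hα1.le (by linarith)
  simpa using this

lemma cB_pos {α β : ℝ} (hα : 0 < α) (hα1 : α < 1) (hβ : α < β) (hβ1 : β ≤ 1) (hβα : β < 2 * α) :
    0 < cB α β := by
  refine lt_of_lt_of_le ?_ (cB_lower hα hα1 hβ.le hβ1 hβα)
  have hI := (trunc_lower hα hα1 hβ.le hβ1 hβα (ε := 1/4) (by norm_num) (by norm_num)).1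
  have hs : ∀ x ∈ Ioo (1/2:ℝ) 1, 0 < WW α β x - WW α α x := fun x hx =>
    WW_sub_pos hα hβ ⟨by linarith [hx.1], hx.2⟩
  rw [setIntegral_pos_iff_support_of_nonneg_ae _ hI]
  · have : Function.support (fun x => WW α β x - WW α α x) ∩ Ioo (1/2) 1 = Ioo (1/2) 1 := by
      rw [inter_eq_right]; intro x hx; exact (hs x hx).ne'
    rw [this]; simp; norm_num
  · exact (ae_restrict_mem measurableSet_Ioo).mono fun x hx => (hs x hx).le

section
variable {E : Type*} [NormedAddCommGroup E] [InnerProductSpace ℝ E] [FiniteDimensional ℝ E]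
  [MeasurableSpace E] [BorelSpace E] 

noncomputable def kerN (α : ℝ) (y : E) : ℝ := ‖y‖ ^ (-((Module.finrank ℝ E : ℝ) + 2 * α))

lemma kerN_nonneg (α : ℝ) (y : E) : 0 ≤ kerN α y := Real.rpow_nonneg (norm_nonneg _) _

lemma kerN_neg (α : ℝ) (y : E) : kerN α (-y) = kerN α y := by simp [kerN]

lemma kerN_meas (α : ℝ) : Measurable (kerN α : E → ℝ) := by
  unfold kerN; fun_prop

lemma finrank_pow [Nontrivial E] {r : ℝ} (hr : 0 < r) :
    r ^ (Module.finrank ℝ E - 1) = r ^ ((Module.finrank ℝ E : ℝ) - 1) := by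
  have : 1 ≤ Module.finrank ℝ E := Module.finrank_pos
  rw [← Real.rpow_natCast, Nat.cast_sub this, Nat.cast_one]

lemma kerN_int_small [Nontrivial E] {α a ρ : ℝ} (ha : 2 * α < a) (hρ : 0 < ρ) :
    IntegrableOn (fun y : E => ‖y‖ ^ a * kerN α y) (closedBall 0 ρ) := by
  rw [← integrable_indicator_iff measurableSet_closedBall]
  have := (integrable_fun_norm_addHaar (E := E) volume (f := fun r : ℝ => (Iic ρ).indicator
    (fun r : ℝ => r ^ a * r ^ (-((Module.finrank ℝ E : ℝ) + 2 * α))) r)).2 ?_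
  · refine this.congr (Eventually.of_forall fun y => ?_)
    by_cases h : ‖y‖ ≤ ρ
    · simp [h, kerN]
    · simp [h]
  · have h1 : IntegrableOn (fun t : ℝ => t ^ (a - 2 * α - 1)) (Ioc 0 ρ) := by
      rw [← intervalIntegrable_iff_integrableOn_Ioc_of_le hρ.le]
      exact intervalIntegral.intervalIntegrable_rpow' (by linarith)
    rw [← integrable_indicator_iff measurableSet_Ioc] at h1
    refine h1.integrableOn.congr_fun (s := Ioi 0) (fun t ht => ?_) measurableSet_Ioi
    have ht0 : 0 < t := ht
    by_cases h : t ≤ ρ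
    · simp only [smul_eq_mul]
      rw [indicator_of_mem (show t ∈ Ioc 0 ρ from ⟨ht0, h⟩), indicator_of_mem (show t ∈ Iic ρ from h),
        finrank_pow ht0, ← Real.rpow_add ht0, ← Real.rpow_add ht0]
      ring_nf
    · simp [h]

lemma kerN_int_large [Nontrivial E] {α a ρ : ℝ} (ha : a < 2 * α) (hρ : 0 < ρ) :
    IntegrableOn (fun y : E => ‖y‖ ^ a * kerN α y) (closedBall 0 ρ)ᶜ := by
  rw [← integrable_indicator_iff measurableSet_closedBall.compl]
  have := (integrable_fun_norm_addHaar (E := E) volume (f := fun r : ℝ => (Ioi ρ).indicator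
    (fun r : ℝ => r ^ a * r ^ (-((Module.finrank ℝ E : ℝ) + 2 * α))) r)).2 ?_
  · refine this.congr (Eventually.of_forall fun y => ?_)
    by_cases h : ‖y‖ ≤ ρ
    · simp [h, kerN]
    · simp [h, kerN, not_le.1 h]
  · have h1 : IntegrableOn (fun t : ℝ => t ^ (a - 2 * α - 1)) (Ioi ρ) :=
      integrableOn_Ioi_rpow_of_lt (by linarith) hρ
    rw [← integrable_indicator_iff measurableSet_Ioi] at h1
    refine h1.integrableOn.congr_fun (s := Ioi 0) (fun t ht => ?_) measurableSet_Ioi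
    have ht0 : 0 < t := ht
    by_cases h : ρ < t
    · simp only [smul_eq_mul]
      rw [indicator_of_mem (show t ∈ Ioi ρ from h), indicator_of_mem (show t ∈ Ioi ρ from h),
        finrank_pow ht0, ← Real.rpow_add ht0, ← Real.rpow_add ht0]
      ring_nf
    · simp [h]

lemma polar_int [Nontrivial E] {F : E → ℝ} (hF : Integrable F) :
    ∫ y, F y = ∫ θ, (∫ r in Ioi (0:ℝ), r ^ ((Module.finrank ℝ E : ℝ) - 1) * F (r • (θ : E)))
      ∂(volume : Measure E).toSphere := by
  have hmp := (volume : Measure E).measurePreserving_homeomorphUnitSphereProd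
  have hme := (homeomorphUnitSphereProd E).measurableEmbedding
  have h1 : ∫ y, F y = ∫ x : ({(0)}ᶜ : Set E), F x.1 ∂((volume : Measure E).comap (↑)) := by
    rw [integral_subtype_comap (measurableSet_singleton _).compl fun x ↦ F x,
      restrict_compl_singleton]
  set g : sphere (0:E) 1 × Ioi (0:ℝ) → ℝ := fun q => F ((q.2 : ℝ) • (q.1 : E)) with hg
  have hgi : ∀ x : ({(0)}ᶜ : Set E), g (homeomorphUnitSphereProd E x) = F x.1 := by
    intro x
    have hx : ‖(x:E)‖ ≠ 0 := norm_ne_zero_iff.2 x.2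
    simp only [hg, homeomorphUnitSphereProd_apply_snd_coe, homeomorphUnitSphereProd_apply_fst_coe]
    rw [smul_smul, mul_inv_cancel₀ hx, one_smul]
  have h2 : ∫ x : ({(0)}ᶜ : Set E), F x.1 ∂((volume : Measure E).comap (↑)) =
      ∫ q, g q ∂((volume : Measure E).toSphere.prod (Measure.volumeIoiPow (Module.finrank ℝ E - 1))) := by
    rw [← hmp.integral_comp hme]
    simp only [hgi]
  have h3 : Integrable g ((volume : Measure E).toSphere.prod
      (Measure.volumeIoiPow (Module.finrank ℝ E - 1))) := by
    rw [← hmp.integrable_comp_emb hme]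
    have : g ∘ (homeomorphUnitSphereProd E) = F ∘ Subtype.val := by
      ext x; exact hgi x
    rw [this, ← integrableOn_iff_comap_subtypeVal (measurableSet_singleton _).compl]
    exact hF.integrableOn
  rw [h1, h2, integral_prod _ h3]
  refine integral_congr_ae (Eventually.of_forall fun θ => ?_)
  simp only [Measure.volumeIoiPow, ENNReal.ofReal]
  rw [integral_withDensity_eq_integral_smul, ← integral_subtype_comap measurableSet_Ioi
      (fun r : ℝ => r ^ ((Module.finrank ℝ E : ℝ) - 1) * F (r • (θ : E)))]
  · refine integral_congr_ae (Eventually.of_forall fun r => ?_)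
    simp only [hg]
    rw [NNReal.smul_def, Real.coe_toNNReal _ (pow_nonneg r.2.out.le _), finrank_pow r.2, smul_eq_mul]
  · exact (measurable_subtype_coe.pow_const _).real_toNNReal
end

section
variable {E : Type*} [NormedAddCommGroup E] [InnerProductSpace ℝ E] [FiniteDimensional ℝ E]
  [MeasurableSpace E] [BorelSpace E]

lemma Q_int [Nontrivial E] {α β : ℝ} (hα : α < 1) (hβ : 0 < β) (hβ1 : β ≤ 1) (hβα : β < 2 * α)
    (a : E) : Integrable (fun y : E => GG β (inner ℝ a y) * kerN α y) := by
  have hm : Measurable (fun y : E => GG β (inner ℝ a y) * kerN α y) := by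
    refine Measurable.mul ?_ (kerN_meas α)
    exact ((GG_cont hβ).comp (continuous_const.inner continuous_id)).measurable
  rw [← integrableOn_univ, ← union_compl_self (closedBall (0:E) 1)]
  refine IntegrableOn.union ?_ ?_
  · refine Integrable.mono' ((kerN_int_small (E := E) (α := α) (a := 2) (ρ := 1) (by linarith)
      one_pos).const_mul (2 * ‖a‖ ^ 2)) hm.aestronglyMeasurable
      (Eventually.of_forall fun y => ?_)
    rw [Real.norm_eq_abs, abs_mul, abs_of_nonneg (kerN_nonneg α y), ← mul_assoc]
    refine mul_le_mul_of_nonneg_right ?_ (kerN_nonneg α y)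
    refine (GG_abs_sq hβ hβ1).trans ?_
    have h := abs_real_inner_le_norm a y
    rw [Real.rpow_two, mul_assoc, ← mul_pow, ← sq_abs (inner ℝ a y)]
    gcongr
  · refine Integrable.mono' ((kerN_int_large (E := E) (α := α) (a := β) (ρ := 1) hβα
      one_pos).const_mul (2 * ‖a‖ ^ β)) hm.aestronglyMeasurable
      (Eventually.of_forall fun y => ?_)
    rw [Real.norm_eq_abs, abs_mul, abs_of_nonneg (kerN_nonneg α y), ← mul_assoc]
    refine mul_le_mul_of_nonneg_right ?_ (kerN_nonneg α y)
    refine (GG_abs_pow hβ hβ1).trans ?_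
    have h := abs_real_inner_le_norm a y
    rw [mul_assoc, ← Real.mul_rpow (norm_nonneg _) (norm_nonneg _)]
    gcongr

lemma Q_eq [Nontrivial E] {α β : ℝ} (hα0 : 0 < α) (hα : α < 1) (hβ : 0 < β) (hβ1 : β ≤ 1) (hβα : β < 2 * α)
    (a : E) : ∫ y : E, GG β (inner ℝ a y) * kerN α y =
      cB α β * ∫ θ, |inner ℝ a (θ:E)| ^ (2 * α) ∂(volume : Measure E).toSphere := by
  rw [polar_int (Q_int hα hβ hβ1 hβα a), ← integral_const_mul]
  refine integral_congr_ae (Eventually.of_forall fun θ => ?_)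
  have hθ : ‖(θ:E)‖ = 1 := by simp
  simp only
  set t := inner ℝ a (θ:E) with ht
  have h1 : ∫ r in Ioi (0:ℝ), r ^ ((Module.finrank ℝ E : ℝ) - 1) *
      (GG β (inner ℝ a (r • (θ:E))) * kerN α (r • (θ:E))) =
      ∫ r in Ioi (0:ℝ), GG β (|t| * r) * r ^ (-1 - 2 * α) := by
    refine setIntegral_congr_fun measurableSet_Ioi fun r hr => ?_
    have hr0 : 0 < r := hr
    have h2 : GG β (inner ℝ a (r • (θ:E))) = GG β (|t| * r) := by
      rw [real_inner_smul_right, ← ht]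
      rcases abs_cases t with ⟨h, _⟩ | ⟨h, _⟩
      · rw [h, mul_comm]
      · rw [h, ← GG_even]; congr 1; ring
    simp only [h2, kerN, norm_smul, hθ, Real.norm_eq_abs, abs_of_pos hr0, mul_one]
    rw [mul_left_comm, ← Real.rpow_add hr0]; ring_nf
  rw [h1]
  rcases (abs_nonneg t).eq_or_lt with h0 | h0
  · rw [← h0, Real.zero_rpow (by positivity)]
    have : GG β 0 = 0 := by simp [GG, pp]; norm_num
    simp [this]
  · have h3 := integral_comp_mul_left_Ioi (fun r => GG β r * r ^ (-1 - 2 * α)) 0 h0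
    rw [mul_zero] at h3
    have h4 : ∫ r in Ioi (0:ℝ), GG β (|t| * r) * r ^ (-1 - 2 * α) =
        |t| ^ (1 + 2 * α) * ∫ r in Ioi (0:ℝ), GG β (|t| * r) * (|t| * r) ^ (-1 - 2 * α) := by
      rw [← integral_const_mul]
      refine setIntegral_congr_fun measurableSet_Ioi fun r hr => ?_
      have hr0 : 0 < r := hr
      rw [Real.mul_rpow h0.le hr0.le, mul_left_comm, ← mul_assoc (|t| ^ (1 + 2 * α)),
        ← Real.rpow_add h0]
      simp
    rw [h4, h3, smul_eq_mul, ← mul_assoc, ← Real.rpow_neg_one, ← Real.rpow_add h0, mul_comm]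
    congr 2; ring

lemma sph_lower [Nontrivial E] {α : ℝ} (hα0 : 0 < α) :
    ∃ c > 0, ∀ a : E, c * ‖a‖ ^ (2 * α) ≤
      ∫ θ, |inner ℝ a (θ:E)| ^ (2 * α) ∂(volume : Measure E).toSphere := by
  set I : E → ℝ := fun a => ∫ θ, |inner ℝ a (θ:E)| ^ (2 * α) ∂(volume : Measure E).toSphere with hI
  have hcθ : ∀ a : E, Continuous fun θ : sphere (0:E) 1 => |inner ℝ a (θ:E)| ^ (2 * α) := fun a =>
    ((continuous_const.inner continuous_subtype_val).abs).rpow_const fun _ => Or.inr (by positivity)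
  have hc : Continuous fun a : sphere (0:E) 1 => I a := by
    refine continuous_of_dominated (bound := fun _ => 1)
      (fun a => (hcθ a).aestronglyMeasurable) (fun a => ?_) (integrable_const _) ?_
    · refine Eventually.of_forall fun θ => ?_
      have h1 : ‖(θ:E)‖ = 1 := by simp
      have h2 : ‖(a:E)‖ = 1 := by simp
      have h := abs_real_inner_le_norm (a:E) θ
      rw [h1, h2, mul_one] at h
      rw [Real.norm_eq_abs, abs_of_nonneg (by positivity)]
      exact Real.rpow_le_one (abs_nonneg _) h (by positivity)
    · refine Eventually.of_forall fun θ => ?_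
      exact ((continuous_subtype_val.inner continuous_const).abs).rpow_const
        fun _ => Or.inr (by positivity)
  haveI : Nonempty (sphere (0:E) 1) := (NormedSpace.sphere_nonempty.2 zero_le_one).to_subtype
  obtain ⟨a0, -, ha0⟩ := isCompact_univ.exists_isMinOn univ_nonempty hc.continuousOn
  refine ⟨I a0, ?_, fun a => ?_⟩
  · refine (hcθ a0).integral_pos_of_hasCompactSupport_nonneg_nonzero (x := a0)
      (HasCompactSupport.of_compactSpace _) (fun θ => by positivity) ?_
    have h2 : ‖(a0:E)‖ = 1 := by simp
    rw [real_inner_self_eq_norm_sq, h2]; simp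
  · rcases eq_or_ne a 0 with h0 | h0
    · subst h0
      rw [norm_zero, Real.zero_rpow (by positivity), mul_zero]
      exact integral_nonneg fun θ => by positivity
    · have hn : 0 < ‖a‖ := norm_pos_iff.2 h0
      have hmem : ‖a‖⁻¹ • a ∈ sphere (0:E) 1 := by
        simp [norm_smul, hn.ne']
      have h1 : I a0 ≤ I (‖a‖⁻¹ • a) := ha0 (mem_univ ⟨_, hmem⟩)
      have h2 : I (‖a‖⁻¹ • a) * ‖a‖ ^ (2 * α) = I a := by
        simp only [hI]
        rw [← integral_mul_const]
        refine integral_congr_ae (Eventually.of_forall fun θ => ?_)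
        simp only
        rw [← Real.mul_rpow (abs_nonneg _) (norm_nonneg _), real_inner_smul_left, abs_mul,
          abs_of_pos (inv_pos.2 hn)]
        congr 1; field_simp
      calc _ ≤ I (‖a‖⁻¹ • a) * ‖a‖ ^ (2 * α) := by gcongr
        _ = _ := h2

lemma Q_nonneg [Nontrivial E] {α : ℝ} (hα0 : 0 < α) (hα : α < 1) (a : E) :
    0 ≤ ∫ y : E, GG α (inner ℝ a y) * kerN α y := by
  rw [Q_eq hα0 hα hα0 hα.le (by linarith)]
  exact mul_nonneg (cB_nonneg hα0 hα) (integral_nonneg fun θ => by positivity)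

lemma Q_lower [Nontrivial E] {α β : ℝ} (hα0 : 0 < α) (hα : α < 1) (hβ : α < β) (hβ1 : β ≤ 1)
    (hβα : β < 2 * α) :
    ∃ c > 0, ∀ a : E, c * ‖a‖ ^ (2 * α) ≤ ∫ y : E, GG β (inner ℝ a y) * kerN α y := by
  obtain ⟨c, hc, h⟩ := sph_lower (E := E) hα0
  have hB := cB_pos hα0 hα hβ hβ1 hβα
  refine ⟨cB α β * c, mul_pos hB hc, fun a => ?_⟩
  rw [Q_eq hα0 hα (hα0.trans hβ) hβ1 hβα, mul_assoc]
  exact mul_le_mul_of_nonneg_left (h a) hB.le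
end

lemma ee_nonneg {β a q : ℝ} (hβ : 0 < β) (hq : 0 ≤ q) : 0 ≤ pp β a - pp β (a - q) :=
  sub_nonneg.2 (pp_mono hβ (by linarith))

lemma ee_small {β s a r κ : ℝ} (hβ : 0 < β) (hβ1 : β ≤ 1) (hs : 0 < s) (hs1 : s ≤ 1) (hr : 0 ≤ r)
    (ha : |a| ≤ 2 * r) (hκ : 0 ≤ κ) :
    pp β (s - a) - pp β (s - a - r ^ 2) ≤ 8 ^ κ * s ^ (-κ) * (r ^ (1 + β) + r ^ (2 * β + κ)) := by
  have h8 : (1:ℝ) ≤ 8 ^ κ := Real.one_le_rpow (by norm_num) hκ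
  have hsk : 1 ≤ s ^ (-κ) := Real.one_le_rpow_of_pos_of_le_one_of_nonpos hs hs1 (by linarith)
  have h1 : (1:ℝ) ≤ 8 ^ κ * s ^ (-κ) := one_le_mul_of_one_le_of_one_le h8 hsk
  rw [abs_le] at ha
  rcases hr.eq_or_lt with h0 | h0
  · subst h0
    simp only [ne_eq, OfNat.ofNat_ne_zero, not_false_eq_true, zero_pow, sub_zero, sub_self]
    positivity
  rcases le_or_gt r (s / 8) with h | h
  · have hq : r ^ 2 ≤ s - a := by nlinarith
    have h2 := pp_sub_le' hβ hβ1 (sq_nonneg r) hq (by linarith : 0 < s - a)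
    have h3 : (s - a) ^ (β - 1) ≤ r ^ (β - 1) :=
      Real.rpow_le_rpow_of_nonpos h0 (by linarith) (by linarith)
    have h4 : r ^ 2 * r ^ (β - 1) = r ^ (1 + β) := by
      rw [← Real.rpow_two, ← Real.rpow_add h0]; ring_nf
    have h5 : r ^ 2 * (s - a) ^ (β - 1) ≤ r ^ (1 + β) := by
      rw [← h4]; gcongr
    have h6 : 0 ≤ r ^ (1 + β) := by positivity
    have h7 : 0 ≤ r ^ (2 * β + κ) := by positivity
    nlinarith
  · have h2 := pp_sub_le hβ hβ1 (sq_nonneg r) (a := s - a)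
    have h3 : (r ^ 2) ^ β = r ^ (2 * β) := by
      rw [← Real.rpow_two, ← Real.rpow_mul hr]
    have h4 : 1 ≤ 8 ^ κ * s ^ (-κ) * r ^ κ := by
      rw [Real.rpow_neg hs.le, ← Real.inv_rpow hs.le, ← Real.mul_rpow (by norm_num) (by positivity),
        ← Real.mul_rpow (by positivity) h0.le]
      refine Real.one_le_rpow ?_ hκ
      rw [← div_eq_mul_inv, div_mul_eq_mul_div, le_div_iff₀ hs]; linarith
    have h5 : r ^ (2 * β + κ) = r ^ (2 * β) * r ^ κ := Real.rpow_add h0 _ _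
    have h6 : 0 ≤ r ^ (1 + β) := by positivity
    have h7 : 0 ≤ r ^ (2 * β) := by positivity
    rw [h3] at h2
    calc _ ≤ r ^ (2 * β) * 1 := by linarith
      _ ≤ r ^ (2 * β) * (8 ^ κ * s ^ (-κ) * r ^ κ) := by gcongr
      _ = 8 ^ κ * s ^ (-κ) * r ^ (2 * β + κ) := by rw [h5]; ring
      _ ≤ _ := by gcongr; linarith

lemma ee_large {β s a r : ℝ} (hβ : 0 < β) (hβ1 : β ≤ 1) (hs : 0 < s) (hs1 : s ≤ 1) (hr : 1 ≤ r)
    (ha : |a| ≤ 2 * r) :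
    pp β (s - a) - pp β (s - a - r ^ 2) ≤ 3 * r ^ β := by
  rw [abs_le] at ha
  have h1 : pp β (s - a) ≤ pp β (3 * r) := pp_mono hβ (by linarith)
  rw [pp_of_pos (a := 3 * r) (by linarith), Real.mul_rpow (by norm_num) (by linarith)] at h1
  have h2 : (3:ℝ) ^ β ≤ 3 ^ (1:ℝ) := Real.rpow_le_rpow_of_exponent_le (by norm_num) hβ1
  rw [Real.rpow_one] at h2
  have h3 : 0 ≤ r ^ β := by positivity
  have := pp_nonneg β (s - a - r ^ 2)
  nlinarith

section
variable {E : Type*} [NormedAddCommGroup E] [InnerProductSpace ℝ E] [FiniteDimensional ℝ E]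
  [MeasurableSpace E] [BorelSpace E]

noncomputable def dlt (u : E → ℝ) (x y : E) : ℝ := u (x + y) + u (x - y) - 2 * u x

noncomputable def VV (β : ℝ) (x : E) : ℝ := pp β (1 - ‖x‖ ^ 2)

noncomputable def DD (β κ : ℝ) (y : E) : ℝ :=
  if ‖y‖ ≤ 1 then ‖y‖ ^ (1 + β) + ‖y‖ ^ (2 * β + κ) else 3 * ‖y‖ ^ β

lemma DD_int [Nontrivial E] {α β κ : ℝ} (h1 : 2 * α < 1 + β) (h2 : 2 * α < 2 * β + κ)
    (h3 : β < 2 * α) : Integrable (fun y : E => DD β κ y * kerN α y) := by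
  rw [← integrableOn_univ, ← union_compl_self (closedBall (0:E) 1)]
  refine IntegrableOn.union ?_ ?_
  · refine ((kerN_int_small (E := E) h1 one_pos).add (kerN_int_small (E := E) h2 one_pos)).congr ?_
    filter_upwards [ae_restrict_mem measurableSet_closedBall] with y hy
    have : ‖y‖ ≤ 1 := by simpa using hy
    simp [DD, this, add_mul]
  · refine ((kerN_int_large (E := E) h3 one_pos).const_mul 3).congr ?_
    filter_upwards [ae_restrict_mem measurableSet_closedBall.compl] with y hy
    have : ¬ ‖y‖ ≤ 1 := by simpa using hy
    simp [DD, this, mul_assoc]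

lemma V_eq {β : ℝ} {ξ y : E} (hξ : ‖ξ‖ < 1) :
    VV β (ξ + y) = (1 - ‖ξ‖ ^ 2) ^ β * pp β (1 - inner ℝ ((2 / (1 - ‖ξ‖ ^ 2)) • ξ) y) -
      (pp β (1 - ‖ξ‖ ^ 2 - 2 * inner ℝ ξ y) -
        pp β (1 - ‖ξ‖ ^ 2 - 2 * inner ℝ ξ y - ‖y‖ ^ 2)) := by
  have hs : 0 < 1 - ‖ξ‖ ^ 2 := by nlinarith [norm_nonneg ξ]
  rw [← pp_scale hs, real_inner_smul_left, VV, norm_add_sq_real]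
  have : (1 - ‖ξ‖ ^ 2) * (1 - 2 / (1 - ‖ξ‖ ^ 2) * inner ℝ ξ y) = 1 - ‖ξ‖ ^ 2 - 2 * inner ℝ ξ y := by
    field_simp
  rw [this]; ring_nf

lemma VV_cont {β : ℝ} (hβ : 0 < β) : Continuous (VV β : E → ℝ) := by
  have := pp_cont hβ
  unfold VV; fun_prop

lemma LV_lower [Nontrivial E] {α β κ : ℝ} (hα : α < 1) (hβ : 0 < β) (hβ1 : β ≤ 1)
    (h1 : 2 * α < 1 + β) (h2 : 2 * α < 2 * β + κ) (h3 : β < 2 * α) (hκ : 0 ≤ κ) :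
    ∃ C ≥ 0, ∀ ξ : E, ‖ξ‖ < 1 → Integrable (fun y => dlt (VV β) ξ y * kerN α y) ∧
      (1 - ‖ξ‖ ^ 2) ^ β * (∫ y : E, GG β (inner ℝ ((2 / (1 - ‖ξ‖ ^ 2)) • ξ) y) * kerN α y)
        - C * (1 - ‖ξ‖ ^ 2) ^ (-κ) ≤ ∫ y, dlt (VV β) ξ y * kerN α y := by
  have hD := DD_int (E := E) h1 h2 h3
  have hD0 : ∀ y : E, 0 ≤ DD β κ y := fun y => by unfold DD; split_ifs <;> positivity
  refine ⟨2 * 8 ^ κ * ∫ y : E, DD β κ y * kerN α y, ?_, fun ξ hξ => ?_⟩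
  · exact mul_nonneg (by positivity) (integral_nonneg fun y => mul_nonneg (hD0 y) (kerN_nonneg α y))
  set s := 1 - ‖ξ‖ ^ 2 with hs_def
  have hs : 0 < s := by rw [hs_def]; nlinarith [norm_nonneg ξ]
  have hs1 : s ≤ 1 := by rw [hs_def]; nlinarith [norm_nonneg ξ]
  set e : E → ℝ := fun y => pp β (s - 2 * inner ℝ ξ y) - pp β (s - 2 * inner ℝ ξ y - ‖y‖ ^ 2) with he
  have he0 : ∀ y, 0 ≤ e y := fun y => ee_nonneg hβ (sq_nonneg _)
  have h8 : (1:ℝ) ≤ 8 ^ κ := Real.one_le_rpow (by norm_num) hκ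
  have hsk : 1 ≤ s ^ (-κ) := Real.one_le_rpow_of_pos_of_le_one_of_nonpos hs hs1 (by linarith)
  have h18 : (1:ℝ) ≤ 8 ^ κ * s ^ (-κ) := one_le_mul_of_one_le_of_one_le h8 hsk
  have hin : ∀ y : E, |2 * (inner ℝ ξ y : ℝ)| ≤ 2 * ‖y‖ := fun y => by
    have := abs_real_inner_le_norm ξ y
    rw [abs_mul, abs_two]; nlinarith [norm_nonneg y]
  have heD : ∀ y, e y ≤ 8 ^ κ * s ^ (-κ) * DD β κ y := fun y => by
    unfold DD
    split_ifs with h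
    · exact ee_small hβ hβ1 hs hs1 (norm_nonneg _) (hin y) hκ
    · refine (ee_large hβ hβ1 hs hs1 (not_le.1 h).le (hin y)).trans ?_
      exact le_mul_of_one_le_left (by positivity) h18
  have hDe : ∀ y : E, DD β κ (-y) = DD β κ y := fun y => by simp [DD]
  have hec : Continuous e := by
    have := pp_cont hβ
    have h' : Continuous fun y : E => inner ℝ ξ y := continuous_const.inner continuous_id
    simp only [he]; fun_prop
  set f : E → ℝ := fun y => (e y + e (-y)) * kerN α y with hf
  have hf0 : ∀ y, 0 ≤ f y := fun y => mul_nonneg (add_nonneg (he0 _) (he0 _)) (kerN_nonneg α y)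
  have hfD : ∀ y, f y ≤ 2 * 8 ^ κ * s ^ (-κ) * (DD β κ y * kerN α y) := fun y => by
    have h1 := heD y
    have h2 := heD (-y)
    rw [hDe] at h2
    rw [← mul_assoc]
    exact mul_le_mul_of_nonneg_right (by linarith) (kerN_nonneg α y)
  have hfi : Integrable f := by
    refine Integrable.mono' (hD.const_mul (2 * 8 ^ κ * s ^ (-κ))) ?_ (Eventually.of_forall fun y => ?_)
    · exact ((by fun_prop : Continuous fun y => e y + e (-y)).measurable.mul
        (kerN_meas α)).aestronglyMeasurable
    · rw [Real.norm_eq_abs, abs_of_nonneg (hf0 y)]; exact hfD y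
  have hfint : ∫ y, f y ≤ 2 * 8 ^ κ * s ^ (-κ) * ∫ y : E, DD β κ (y:E) * kerN α (y:E) := by
    rw [← integral_const_mul]
    exact integral_mono hfi (hD.const_mul _) hfD
  have hQ := (Q_int (E := E) hα hβ hβ1 h3 ((2 / s) • ξ)).const_mul (s ^ β)
  have heq : ∀ y, dlt (VV β) ξ y * kerN α y =
      s ^ β * (GG β (inner ℝ ((2 / s) • ξ) y) * kerN α y) - f y := fun y => by
    have hA := V_eq (β := β) (y := y) hξ
    have hB := V_eq (β := β) (y := -y) hξ
    have hC : VV β ξ = s ^ β := by rw [VV, pp_of_pos hs.le]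
    rw [dlt, sub_eq_add_neg ξ y, hA, hB, hC]
    simp only [hf, he, GG, inner_neg_right, norm_neg, ← hs_def]
    ring_nf
  refine ⟨(hQ.sub hfi).congr (Eventually.of_forall fun y => (heq y).symm), ?_⟩
  rw [integral_congr_ae (Eventually.of_forall heq), integral_sub hQ hfi, integral_const_mul]
  linarith
end

section
variable {E : Type*} [NormedAddCommGroup E] [InnerProductSpace ℝ E] [FiniteDimensional ℝ E]
  [MeasurableSpace E] [BorelSpace E]

structure Barrier (α ρ C : ℝ) (v : E → ℝ) : Prop where
  ρ0 : 0 < ρ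
  ρ1 : ρ < 1
  C0 : 0 < C
  cont : Continuous v
  nonneg : ∀ x, 0 ≤ v x
  zero : ∀ x, 1 ≤ ‖x‖ → v x = 0
  lower : ∀ x, ‖x‖ ≤ 1 → (1 - ‖x‖ ^ 2) ^ α ≤ v x
  upper : ∀ x, ‖x‖ ≤ 1 → v x ≤ 2 * (1 - ‖x‖ ^ 2) ^ α
  conc : ∀ ξ y, ‖ξ + y‖ ≤ 1 → ‖ξ - y‖ ≤ 1 → dlt v ξ y ≤ 0
  int : ∀ ξ, ‖ξ‖ < 1 → Integrable (fun y => dlt v ξ y * kerN α y)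
  lap : ∀ ξ, ‖ξ‖ < 1 → -C ≤ ∫ y, dlt v ξ y * kerN α y
  lap' : ∀ ξ, ‖ξ‖ < 1 → ρ < ‖ξ‖ → 0 ≤ ∫ y, dlt v ξ y * kerN α y

lemma VV_conc {β : ℝ} (hβ : 0 < β) (hβ1 : β ≤ 1) (ξ y : E) (h1 : ‖ξ + y‖ ≤ 1) (h2 : ‖ξ - y‖ ≤ 1) :
    dlt (VV β) ξ y ≤ 0 := by
  have hA : 0 ≤ 1 - ‖ξ + y‖ ^ 2 := by nlinarith [norm_nonneg (ξ + y)]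
  have hB : 0 ≤ 1 - ‖ξ - y‖ ^ 2 := by nlinarith [norm_nonneg (ξ - y)]
  have hp := parallelogram_law_with_norm ℝ ξ y
  have hs : (1/2 : ℝ) * (1 - ‖ξ + y‖ ^ 2) + (1/2) * (1 - ‖ξ - y‖ ^ 2) ≤ 1 - ‖ξ‖ ^ 2 := by nlinarith [norm_nonneg y]
  have hc := (Real.concaveOn_rpow hβ.le hβ1).2 (mem_Ici.2 hA) (mem_Ici.2 hB)
    (by norm_num : (0:ℝ) ≤ 1/2) (by norm_num : (0:ℝ) ≤ 1/2) (by norm_num)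
  simp only [smul_eq_mul] at hc
  have hm := Real.rpow_le_rpow (by positivity) hs hβ.le
  unfold dlt VV
  rw [pp_of_pos hA, pp_of_pos hB, pp_of_pos (by linarith)]
  linarith

lemma barrier_exists [Nontrivial E] {α : ℝ} (hα0 : 0 < α) (hα : α < 1) :
    ∃ (v : E → ℝ) (ρ C : ℝ), Barrier α ρ C v := by
  obtain ⟨b, hb1, hb2⟩ := exists_between (lt_min (by linarith : α < 2 * α) hα)
  have hb3 : b < 2 * α := hb2.trans_le (min_le_left _ _)
  have hb4 : b < 1 := hb2.trans_le (min_le_right _ _)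
  have hb0 : 0 < b := hα0.trans hb1
  obtain ⟨κ, hκ⟩ : ∃ κ, κ = (2 * α - b) / 2 := ⟨_, rfl⟩
  have hκ0 : 0 < κ := by rw [hκ]; linarith
  obtain ⟨c, hc, hQb⟩ := Q_lower (E := E) hα0 hα hb1 hb4.le hb3
  obtain ⟨C1, hC1, H1⟩ := LV_lower (E := E) (κ := κ) hα hα0 hα.le (by linarith) (by linarith)
    (by linarith) hκ0.le
  obtain ⟨C2, hC2, H2⟩ := LV_lower (E := E) (κ := κ) hα hb0 hb4.le (by linarith) (by linarith)
    hb3 hκ0.le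
  set C' := C1 + C2 + 1 with hC'
  have hC'0 : 0 < C' := by positivity
  set v : E → ℝ := fun x => VV α x + VV b x with hv
  have hdlt : ∀ ξ y, dlt v ξ y = dlt (VV α) ξ y + dlt (VV b) ξ y := fun ξ y => by
    simp only [dlt, hv]; ring
  have hdk : ∀ ξ y, dlt v ξ y * kerN α y = dlt (VV α) ξ y * kerN α y + dlt (VV b) ξ y * kerN α y :=
    fun ξ y => by rw [hdlt, add_mul]
  have hs0 : ∀ x : E, ‖x‖ ≤ 1 → 0 ≤ 1 - ‖x‖ ^ 2 := fun x hx => by nlinarith [norm_nonneg x]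
  have hs0' : ∀ x : E, ‖x‖ < 1 → 0 < 1 - ‖x‖ ^ 2 := fun x hx => by nlinarith [norm_nonneg x]
  have hs1 : ∀ x : E, 1 - ‖x‖ ^ 2 ≤ 1 := fun x => by nlinarith [norm_nonneg x]
  have main : ∀ ξ : E, ‖ξ‖ < 1 → (1 - ‖ξ‖ ^ 2) ^ (-κ) *
      (c * (2 * ‖ξ‖) ^ (2 * α) * (1 - ‖ξ‖ ^ 2) ^ (-κ) - C') ≤ ∫ y, dlt v ξ y * kerN α y := by
    intro ξ hξ
    obtain ⟨i1, l1⟩ := H1 ξ hξ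
    obtain ⟨i2, l2⟩ := H2 ξ hξ
    simp only [hdk]
    rw [integral_add i1 i2]
    have hs := hs0' ξ hξ
    set s := 1 - ‖ξ‖ ^ 2 with hsd
    have hq1 := Q_nonneg hα0 hα ((2 / s) • ξ)
    have hq2 := hQb ((2 / s) • ξ)
    have e1 : ‖(2 / s) • ξ‖ ^ (2 * α) = (2 * ‖ξ‖) ^ (2 * α) * s ^ (-(2 * α)) := by
      rw [norm_smul, Real.norm_eq_abs, abs_of_pos (by positivity), div_mul_eq_mul_div,
        Real.div_rpow (by positivity) hs.le, Real.rpow_neg hs.le, div_eq_mul_inv]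
    have e2 : s ^ b * s ^ (-(2 * α)) = s ^ (-κ) * s ^ (-κ) := by
      rw [← Real.rpow_add hs, ← Real.rpow_add hs, hκ]; ring_nf
    have h1 : 0 ≤ s ^ α * ∫ y : E, GG α (inner ℝ ((2 / s) • ξ) y) * kerN α y :=
      mul_nonneg (by positivity) hq1
    have h2 : s ^ b * (c * ‖(2 / s) • ξ‖ ^ (2 * α)) ≤
      s ^ b * ∫ y : E, GG b (inner ℝ ((2 / s) • ξ) y) * kerN α y :=
      mul_le_mul_of_nonneg_left hq2 (by positivity)
    have h3 : s ^ b * (c * ‖(2 / s) • ξ‖ ^ (2 * α)) = c * (2 * ‖ξ‖) ^ (2 * α) * (s ^ (-κ) * s ^ (-κ)) := by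
      rw [e1, ← e2]; ring
    have h4 : 0 ≤ s ^ (-κ) := by positivity
    rw [hC']
    nlinarith
  set s0 := min (3/4) ((c / C') ^ (1 / κ)) with hs0d
  have hs00 : 0 < s0 := lt_min (by norm_num) (by positivity)
  have hs01 : s0 ≤ 3/4 := min_le_left _ _
  have hs02 : s0 ^ κ ≤ c / C' := by
    calc s0 ^ κ ≤ ((c / C') ^ (1 / κ)) ^ κ := Real.rpow_le_rpow hs00.le (min_le_right _ _) hκ0.le
      _ = _ := by rw [← Real.rpow_mul (by positivity), one_div, inv_mul_cancel₀ hκ0.ne', Real.rpow_one]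
  refine ⟨v, √(1 - s0), C' * s0 ^ (-κ), ⟨?_, ?_, by positivity, ?_, ?_, ?_, ?_, ?_, ?_, ?_, ?_, ?_⟩⟩
  · exact Real.sqrt_pos.2 (by linarith)
  · rw [Real.sqrt_lt' one_pos]; linarith
  · exact (VV_cont hα0).add (VV_cont hb0)
  · exact fun x => add_nonneg (pp_nonneg _ _) (pp_nonneg _ _)
  · intro x hx
    have : 1 - ‖x‖ ^ 2 ≤ 0 := by nlinarith
    simp only [hv, VV]
    rw [pp_of_neg hα0 this, pp_of_neg hb0 this, add_zero]
  · intro x hx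
    simp only [hv, VV]
    rw [pp_of_pos (hs0 x hx)]
    linarith [pp_nonneg b (1 - ‖x‖ ^ 2)]
  · intro x hx
    simp only [hv, VV]
    rw [pp_of_pos (hs0 x hx), pp_of_pos (hs0 x hx)]
    have : (1 - ‖x‖ ^ 2) ^ b ≤ (1 - ‖x‖ ^ 2) ^ α := by
      rcases (hs0 x hx).eq_or_lt with h | h
      · rw [← h, Real.zero_rpow hα0.ne', Real.zero_rpow hb0.ne']
      · exact Real.rpow_le_rpow_of_exponent_ge h (hs1 x) hb1.le
    linarith
  · intro ξ y h1 h2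
    rw [hdlt]
    linarith [VV_conc hα0 hα.le ξ y h1 h2, VV_conc hb0 hb4.le ξ y h1 h2]
  · intro ξ hξ
    simp only [hdk]
    exact (H1 ξ hξ).1.add (H2 ξ hξ).1
  · intro ξ hξ
    have hm := main ξ hξ
    have hs := hs0' ξ hξ
    set s := 1 - ‖ξ‖ ^ 2 with hsd
    rcases le_or_gt s s0 with h | h
    · have hξ2 : 1 ≤ 2 * ‖ξ‖ := by nlinarith [norm_nonneg ξ]
      have h1 : 1 ≤ (2 * ‖ξ‖) ^ (2 * α) := Real.one_le_rpow hξ2 (by positivity)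
      have h2 : s ^ κ ≤ c / C' := (Real.rpow_le_rpow hs.le h hκ0.le).trans hs02
      have h3 : C' ≤ c * s ^ (-κ) := by
        rw [Real.rpow_neg hs.le, ← div_eq_mul_inv, le_div_iff₀ (by positivity)]
        rw [le_div_iff₀ hC'0] at h2; linarith
      have h4 : 0 ≤ s ^ (-κ) := by positivity
      have h5 : c * s ^ (-κ) ≤ c * (2 * ‖ξ‖) ^ (2 * α) * s ^ (-κ) := by
        have : c * 1 * s ^ (-κ) ≤ c * (2 * ‖ξ‖) ^ (2 * α) * s ^ (-κ) := by gcongr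
        linarith
      have h6 : 0 ≤ s ^ (-κ) * (c * (2 * ‖ξ‖) ^ (2 * α) * s ^ (-κ) - C') :=
        mul_nonneg h4 (by linarith)
      have h7 : 0 ≤ C' * s0 ^ (-κ) := by positivity
      linarith
    · have h1 : s ^ (-κ) ≤ s0 ^ (-κ) := Real.rpow_le_rpow_of_nonpos hs00 h.le (by linarith)
      have h2 : 0 ≤ s ^ (-κ) * (c * (2 * ‖ξ‖) ^ (2 * α) * s ^ (-κ)) := by positivity
      nlinarith
  · intro ξ hξ hρ
    have hm := main ξ hξ
    have hs := hs0' ξ hξ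
    have hρ2 : 1 - s0 < ‖ξ‖ ^ 2 := by
      rwa [Real.sqrt_lt' (lt_of_le_of_lt (Real.sqrt_nonneg _) hρ)] at hρ
    set s := 1 - ‖ξ‖ ^ 2 with hsd
    have h : s ≤ s0 := by linarith
    have hξ2 : 1 ≤ 2 * ‖ξ‖ := by nlinarith [norm_nonneg ξ]
    have h1 : 1 ≤ (2 * ‖ξ‖) ^ (2 * α) := Real.one_le_rpow hξ2 (by positivity)
    have h2 : s ^ κ ≤ c / C' := (Real.rpow_le_rpow hs.le h hκ0.le).trans hs02
    have h3 : C' ≤ c * s ^ (-κ) := by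
      rw [Real.rpow_neg hs.le, ← div_eq_mul_inv, le_div_iff₀ (by positivity)]
      rw [le_div_iff₀ hC'0] at h2; linarith
    have h4 : 0 ≤ s ^ (-κ) := by positivity
    have h5 : c * s ^ (-κ) ≤ c * (2 * ‖ξ‖) ^ (2 * α) * s ^ (-κ) := by
      have : c * 1 * s ^ (-κ) ≤ c * (2 * ‖ξ‖) ^ (2 * α) * s ^ (-κ) := by gcongr
      linarith
    exact (mul_nonneg h4 (by linarith)).trans hm
end

section
variable {E : Type*} [NormedAddCommGroup E] [InnerProductSpace ℝ E] [FiniteDimensional ℝ E]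
  [MeasurableSpace E] [BorelSpace E]

structure SupSol (α p : ℝ) (e : E) (u : E → ℝ) : Prop where
  cont : Continuous u
  nonneg : ∀ x, 0 ≤ u x
  pos : ∀ x, 0 < inner ℝ e x → 0 < u x
  int : ∀ x, 0 < inner ℝ e x → Integrable (fun y => dlt u x y * kerN α y)
  ineq : ∀ x, 0 < inner ℝ e x → (∫ y, dlt u x y * kerN α y) + u x ^ p ≤ 0

noncomputable def xi (e : E) (R : ℝ) (x : E) : E := R⁻¹ • x - e

noncomputable def vR (v : E → ℝ) (e : E) (R : ℝ) (x : E) : ℝ := v (xi e R x)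

lemma xi_sq {e : E} (he : ‖e‖ = 1) (R : ℝ) (x : E) :
    1 - ‖xi e R x‖ ^ 2 = 2 * R⁻¹ * inner ℝ e x - (R⁻¹ * ‖x‖) ^ 2 := by
  rw [xi, norm_sub_sq_real, he, norm_smul, real_inner_smul_left, real_inner_comm, Real.norm_eq_abs,
    mul_pow, sq_abs]
  ring

lemma xi_cont (e : E) (R : ℝ) : Continuous (xi e R) := by unfold xi; fun_prop

lemma xi_pos {e : E} (he : ‖e‖ = 1) {R : ℝ} (hR : 0 < R) {x : E} (h : ‖xi e R x‖ < 1) :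
    0 < inner ℝ e x := by
  have h1 := xi_sq he R x
  have h2 : 0 < 1 - ‖xi e R x‖ ^ 2 := by nlinarith [norm_nonneg (xi e R x)]
  have h3 : 0 < 2 * R⁻¹ * inner ℝ e x := by nlinarith [sq_nonneg (R⁻¹ * ‖x‖)]
  exact pos_of_mul_pos_right h3 (by positivity)

lemma xi_norm {e : E} (he : ‖e‖ = 1) {R : ℝ} (hR : 0 < R) {x : E} (h : ‖xi e R x‖ ≤ 1) :
    ‖x‖ ≤ 2 * R := by
  have : ‖R⁻¹ • x‖ ≤ 2 := by
    calc ‖R⁻¹ • x‖ = ‖xi e R x + e‖ := by simp [xi]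
      _ ≤ ‖xi e R x‖ + ‖e‖ := norm_add_le _ _
      _ ≤ 2 := by linarith
  rw [norm_smul, norm_inv, Real.norm_eq_abs, abs_of_pos hR, inv_mul_le_iff₀ hR] at this
  linarith

lemma xi_inner {e : E} (he : ‖e‖ = 1) {R ρ : ℝ} (hR : 0 < R) {x : E} (h : ‖xi e R x‖ ≤ ρ) :
    (1 - ρ) * R ≤ inner ℝ e x := by
  have h1 : inner ℝ e (R⁻¹ • x) = 1 + inner ℝ e (xi e R x) := by
    rw [xi, inner_sub_right, real_inner_self_eq_norm_sq, he]; ring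
  have h2 := abs_real_inner_le_norm e (xi e R x)
  rw [he, one_mul] at h2
  have h3 := (abs_le.1 h2).1
  rw [real_inner_smul_right] at h1
  have h4 : 1 - ρ ≤ R⁻¹ * inner ℝ e x := by linarith
  rw [le_inv_mul_iff₀ hR] at h4
  linarith

lemma inner_le_norm' {e : E} (he : ‖e‖ = 1) (x : E) : inner ℝ e x ≤ ‖x‖ := by
  have := real_inner_le_norm e x
  rwa [he, one_mul] at this

lemma xi_sq_le {e : E} (he : ‖e‖ = 1) {R : ℝ} (hR : 0 < R) (x : E) :
    1 - ‖xi e R x‖ ^ 2 ≤ 2 * ‖x‖ / R := by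
  rw [xi_sq he]
  have := inner_le_norm' he x
  have h2 : R⁻¹ * inner ℝ e x ≤ R⁻¹ * ‖x‖ := by gcongr
  rw [div_eq_mul_inv]
  nlinarith [sq_nonneg (R⁻¹ * ‖x‖)]

lemma xi_sq_ge {e : E} (he : ‖e‖ = 1) {R R' ρ : ℝ} (hR' : 0 < R') (hρ : ρ < 1)
    (hRR : 4 / (1 - ρ) * R' ≤ R) {x : E} (hx : ‖xi e R' x‖ ≤ ρ) :
    (1 - ρ) * (R' / R) ≤ 1 - ‖xi e R x‖ ^ 2 := by
  have h1 := xi_inner he hR' hx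
  have h2 := xi_norm he hR' (hx.trans hρ.le)
  have hρ' : 0 < 1 - ρ := by linarith
  have hR : 0 < R := lt_of_lt_of_le (by positivity) hRR
  rw [div_mul_eq_mul_div, div_le_iff₀ hρ'] at hRR
  rw [xi_sq he]
  have e1 : 2 * R⁻¹ * inner ℝ e x - (R⁻¹ * ‖x‖) ^ 2 = (2 * R * inner ℝ e x - ‖x‖ ^ 2) / R ^ 2 := by
    field_simp
  rw [e1, le_div_iff₀ (by positivity)]
  have e2 : (1 - ρ) * (R' / R) * R ^ 2 = (1 - ρ) * R' * R := by field_simp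
  rw [e2]
  have h3 : ‖x‖ ^ 2 ≤ (2 * R') ^ 2 := by gcongr
  nlinarith [mul_le_mul_of_nonneg_left h1 hR.le, mul_le_mul_of_nonneg_left hRR hR'.le]

lemma kerN_smul {α R : ℝ} (hR : 0 < R) (y : E) :
    kerN α y = R ^ (-((Module.finrank ℝ E : ℝ) + 2 * α)) * kerN α (R⁻¹ • y) := by
  unfold kerN
  rw [← Real.mul_rpow hR.le (norm_nonneg _), norm_smul, norm_inv, Real.norm_eq_abs, abs_of_pos hR,
    mul_inv_cancel_left₀ hR.ne']

lemma dlt_vR (v : E → ℝ) (e : E) (R : ℝ) (x y : E) :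
    dlt (vR v e R) x y = dlt v (xi e R x) (R⁻¹ • y) := by
  simp only [dlt, vR, xi, smul_add, smul_sub]
  rw [show R⁻¹ • x + R⁻¹ • y - e = R⁻¹ • x - e + R⁻¹ • y by abel,
    show R⁻¹ • x - R⁻¹ • y - e = R⁻¹ • x - e - R⁻¹ • y by abel]

lemma dlt_vR_ker {α : ℝ} (v : E → ℝ) (e : E) {R : ℝ} (hR : 0 < R) (x y : E) :
    dlt (vR v e R) x y * kerN α y = R ^ (-((Module.finrank ℝ E : ℝ) + 2 * α)) *
      (fun z => dlt v (xi e R x) z * kerN α z) (R⁻¹ • y) := by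
  rw [dlt_vR, kerN_smul hR]; ring

lemma int_vR {α : ℝ} {v : E → ℝ} {e : E} {R : ℝ} (hR : 0 < R) {x : E}
    (h : Integrable (fun z => dlt v (xi e R x) z * kerN α z)) :
    Integrable (fun y => dlt (vR v e R) x y * kerN α y) := by
  simp only [dlt_vR_ker v e hR]
  exact ((integrable_comp_smul_iff volume _ (inv_ne_zero hR.ne')).2 h).const_mul _

lemma lap_vR {α : ℝ} {v : E → ℝ} {e : E} {R : ℝ} (hR : 0 < R) {x : E} :
    ∫ y, dlt (vR v e R) x y * kerN α y = R ^ (-(2 * α)) * ∫ z, dlt v (xi e R x) z * kerN α z := by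
  simp only [dlt_vR_ker v e hR]
  rw [integral_const_mul, Measure.integral_comp_inv_smul_of_nonneg volume
      (fun z => dlt v (xi e R x) z * kerN α z) hR.le, smul_eq_mul,
    ← mul_assoc, ← Real.rpow_natCast, ← Real.rpow_add hR]
  congr 2; ring

/-- comparison with finite sums of barriers -/
lemma barrier_cmp {α p ρ C : ℝ} {v : E → ℝ} {e : E} {u : E → ℝ} (hv : Barrier α ρ C v) (he : ‖e‖ = 1)
    (hu : SupSol α p e u) (s : Finset ℕ) (c R : ℕ → ℝ) (hc : ∀ k, 0 ≤ c k) (hR : ∀ k, 0 < R k)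
    (hx : ∃ x, u x < ∑ k ∈ s, c k * vR v e (R k) x) :
    ∃ x, 0 < inner ℝ e x ∧ u x < ∑ k ∈ s, c k * vR v e (R k) x ∧
      u x ^ p ≤ ∑ k ∈ s.filter (fun k => ‖xi e (R k) x‖ ≤ ρ), c k * (C * R k ^ (-(2 * α))) := by
  classical
  obtain ⟨x1, hx1⟩ := hx
  have hvc : ∀ k, Continuous (vR v e (R k)) := fun k => hv.cont.comp (xi_cont e _)
  have hz : ∀ k x, 1 ≤ ‖xi e (R k) x‖ → vR v e (R k) x = 0 := fun k x h => hv.zero _ h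
  have hnn : ∀ k x, 0 ≤ c k * vR v e (R k) x := fun k x => mul_nonneg (hc k) (hv.nonneg _)
  have hwc : Continuous fun x => u x - ∑ k ∈ s, c k * vR v e (R k) x :=
    hu.cont.sub (continuous_finsetSum _ fun k _ => continuous_const.mul (hvc k))
  obtain ⟨x0, hx0⟩ := hwc.exists_forall_le' x1 (by
    have h1 : ∀ k ∈ s, ∀ᶠ x in cocompact E, vR v e (R k) x = 0 := fun k _ => by
      have : ∀ᶠ x in cocompact E, 2 * R k < ‖x‖ :=
        (tendsto_norm_cocompact_atTop (E := E)).eventually_gt_atTop _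
      filter_upwards [this] with x hx
      refine hz k x ?_
      by_contra hcon
      exact absurd (xi_norm he (hR k) (not_le.1 hcon).le) (not_le.2 hx)
    filter_upwards [(Filter.eventually_all_finset s).2 h1] with x hx
    have h0 : ∑ k ∈ s, c k * vR v e (R k) x = 0 :=
      Finset.sum_eq_zero fun k hk => by rw [hx k hk, mul_zero]
    linarith [hu.nonneg x])
  have hlt : u x0 < ∑ k ∈ s, c k * vR v e (R k) x0 := by linarith [hx0 x1]
  set t := s.filter (fun k => ‖xi e (R k) x0‖ < 1) with ht
  have hsub : t ⊆ s := Finset.filter_subset _ _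
  have hw0 : ∑ k ∈ t, c k * vR v e (R k) x0 = ∑ k ∈ s, c k * vR v e (R k) x0 := by
    refine Finset.sum_subset hsub fun k hk hkt => ?_
    have : 1 ≤ ‖xi e (R k) x0‖ := by
      by_contra hcon
      exact hkt (Finset.mem_filter.2 ⟨hk, not_le.1 hcon⟩)
    rw [hz k x0 this, mul_zero]
  have hwle : ∀ x, ∑ k ∈ t, c k * vR v e (R k) x ≤ ∑ k ∈ s, c k * vR v e (R k) x := fun x =>
    Finset.sum_le_sum_of_subset_of_nonneg hsub fun k _ _ => hnn k x
  have htne : t.Nonempty := by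
    rw [Finset.nonempty_iff_ne_empty]
    intro h
    rw [← hw0, h, Finset.sum_empty] at hlt
    linarith [hu.nonneg x0]
  obtain ⟨k0, hk0⟩ := htne
  have hH : 0 < inner ℝ e x0 := xi_pos he (hR k0) (Finset.mem_filter.1 hk0).2
  refine ⟨x0, hH, hlt, ?_⟩
  have hd : ∀ y, ∑ k ∈ t, c k * dlt (vR v e (R k)) x0 y ≤ dlt u x0 y := fun y => by
    have e1 : ∑ k ∈ t, c k * dlt (vR v e (R k)) x0 y = ∑ k ∈ t, c k * vR v e (R k) (x0 + y) +
        ∑ k ∈ t, c k * vR v e (R k) (x0 - y) - 2 * ∑ k ∈ t, c k * vR v e (R k) x0 := by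
      rw [Finset.mul_sum, ← Finset.sum_add_distrib, ← Finset.sum_sub_distrib]
      exact Finset.sum_congr rfl fun k _ => by rw [dlt]; ring
    rw [e1, hw0, dlt]
    linarith [hx0 (x0 + y), hx0 (x0 - y), hwle (x0 + y), hwle (x0 - y)]
  have hti : ∀ k ∈ t, Integrable fun y => c k * (dlt (vR v e (R k)) x0 y * kerN α y) := fun k hk =>
    (int_vR (hR k) (hv.int _ (Finset.mem_filter.1 hk).2)).const_mul _
  have h1 : ∑ k ∈ t, c k * ∫ y, dlt (vR v e (R k)) x0 y * kerN α y ≤ ∫ y, dlt u x0 y * kerN α y := by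
    simp only [← integral_const_mul]
    rw [← integral_finsetSum t hti]
    refine integral_mono (integrable_finsetSum t hti) (hu.int x0 hH) fun y => ?_
    simp only [← mul_assoc]
    rw [← Finset.sum_mul]
    exact mul_le_mul_of_nonneg_right (hd y) (kerN_nonneg α y)
  have h2 : -∑ k ∈ s.filter (fun k => ‖xi e (R k) x0‖ ≤ ρ), c k * (C * R k ^ (-(2 * α))) ≤
      ∑ k ∈ t, c k * ∫ y, dlt (vR v e (R k)) x0 y * kerN α y := by
    have hf : s.filter (fun k => ‖xi e (R k) x0‖ ≤ ρ) = t.filter (fun k => ‖xi e (R k) x0‖ ≤ ρ) := by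
      ext k
      simp only [ht, Finset.mem_filter]
      have := hv.ρ1
      constructor
      · rintro ⟨a, b⟩; exact ⟨⟨a, by linarith⟩, b⟩
      · rintro ⟨⟨a, _⟩, b⟩; exact ⟨a, b⟩
    rw [hf, Finset.sum_filter, ← Finset.sum_neg_distrib]
    refine Finset.sum_le_sum fun k hk => ?_
    have hk1 := (Finset.mem_filter.1 hk).2
    have hRp : 0 < R k ^ (-(2 * α)) := Real.rpow_pos_of_pos (hR k) _
    rw [lap_vR (hR k)]
    split_ifs with h
    · have := mul_le_mul_of_nonneg_left (mul_le_mul_of_nonneg_left (hv.lap _ hk1) hRp.le) (hc k)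
      linarith
    · rw [neg_zero]
      exact mul_nonneg (hc k) (mul_nonneg hRp.le (hv.lap' _ hk1 (not_le.1 h)))
  have h3 := hu.ineq x0 hH
  linarith
end

section
variable {E : Type*} [NormedAddCommGroup E] [InnerProductSpace ℝ E] [FiniteDimensional ℝ E]
  [MeasurableSpace E] [BorelSpace E]

lemma vR_upper {α ρ C : ℝ} {v : E → ℝ} {e : E} (hα : 0 < α) (hv : Barrier α ρ C v) (he : ‖e‖ = 1)
    {R : ℝ} (hR : 0 < R) (x : E) : vR v e R x ≤ 2 * (2 * ‖x‖ / R) ^ α := by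
  rcases le_or_gt ‖xi e R x‖ 1 with h | h
  · refine (hv.upper _ h).trans ?_
    have h1 : 0 ≤ 1 - ‖xi e R x‖ ^ 2 := by nlinarith [norm_nonneg (xi e R x)]
    have := Real.rpow_le_rpow h1 (xi_sq_le he hR x) hα.le
    linarith
  · rw [vR, hv.zero _ h.le]; positivity

lemma vR_e {α ρ C : ℝ} {v : E → ℝ} {e : E} (hα : 0 < α) (hv : Barrier α ρ C v) (he : ‖e‖ = 1)
    {R : ℝ} (hR : 1 ≤ R) : R ^ (-α) ≤ vR v e R e := by
  have hR0 : 0 < R := by linarith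
  have h := xi_sq he R e
  rw [real_inner_self_eq_norm_sq, he] at h
  have h1 : R⁻¹ ≤ 1 := inv_le_one_of_one_le₀ hR
  have h2 : 0 < R⁻¹ := by positivity
  have h3 : R⁻¹ ≤ 1 - ‖xi e R e‖ ^ 2 := by rw [h]; nlinarith
  have h4 : ‖xi e R e‖ ≤ 1 := by nlinarith [norm_nonneg (xi e R e)]
  refine le_trans ?_ (hv.lower _ h4)
  rw [Real.rpow_neg hR0.le, ← Real.inv_rpow hR0.le]
  exact Real.rpow_le_rpow h2.le h3 hα.le

lemma KR_compact (e : E) (R ρ : ℝ) (hR : 0 < R) : IsCompact {x : E | ‖xi e R x‖ ≤ ρ} := by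
  refine isCompact_of_isClosed_isBounded (isClosed_le (xi_cont e R).norm continuous_const) ?_
  refine (isBounded_closedBall (x := (0:E)) (r := R * (ρ + ‖e‖))).subset fun x hx => ?_
  rw [mem_closedBall_zero_iff]
  have h1 : R⁻¹ • x = xi e R x + e := by simp [xi]
  have h2 : ‖R⁻¹ • x‖ ≤ ρ + ‖e‖ := by
    rw [h1]; exact (norm_add_le _ _).trans (by have : ‖xi e R x‖ ≤ ρ := hx; linarith)
  rwa [norm_smul, norm_inv, Real.norm_eq_abs, abs_of_pos hR, inv_mul_le_iff₀ hR] at h2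

lemma KR_center (e : E) {R : ℝ} (hR : 0 < R) : xi e R (R • e) = 0 := by
  simp [xi, smul_smul, hR.ne']

lemma case_mid {α p ρ C : ℝ} {v : E → ℝ} {e : E} {u : E → ℝ} (hα : 0 < α) (hv : Barrier α ρ C v)
    (he : ‖e‖ = 1) (hu : SupSol α p e u) (hp0 : 0 ≤ p) (hp1 : p ≤ 1) : False := by
  have hC := hv.C0
  have hρ0 := hv.ρ0
  have hρ1 := hv.ρ1
  have hρs : 0 < 1 - ρ ^ 2 := by nlinarith
  have t1 : Tendsto (fun R : ℝ => (1 - ρ ^ 2) ^ α / (2 * C) * R ^ (2 * α)) atTop atTop :=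
    (tendsto_rpow_atTop (by positivity)).const_mul_atTop (by positivity)
  have t2 : Tendsto (fun R : ℝ => R ^ α / (2 * C)) atTop atTop :=
    (tendsto_rpow_atTop hα).atTop_div_const (by positivity)
  obtain ⟨R, hR1, hRa, hRb⟩ := ((eventually_ge_atTop (1:ℝ)).and
    ((t1.eventually_gt_atTop 1).and (t2.eventually_gt_atTop (u e)))).exists
  have hR : 0 < R := by linarith
  obtain ⟨xm, hxm, hmin⟩ := (KR_compact e R ρ hR).exists_isMinOn
    ⟨R • e, by simp [KR_center e hR, hρ0.le]⟩ hu.cont.continuousOn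
  have hxm' : ‖xi e R xm‖ ≤ ρ := hxm
  obtain ⟨m, hm⟩ : ∃ m, m = u xm := ⟨_, rfl⟩
  have hm0 : 0 < m := hm ▸ hu.pos _ (xi_pos he hR (hxm'.trans_lt hρ1))
  obtain ⟨c, hc⟩ : ∃ c, c = m ^ p * R ^ (2 * α) / (2 * C) := ⟨_, rfl⟩
  have hc0 : 0 ≤ c := by rw [hc]; positivity
  have key : ∀ x, c * vR v e R x ≤ u x := by
    by_contra hcon
    push Not at hcon
    obtain ⟨x1, hx1⟩ := hcon
    obtain ⟨x, hH, hlt, hle⟩ := barrier_cmp hv he hu {0} (fun _ => c) (fun _ => R) (fun _ => hc0)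
      (fun _ => hR) ⟨x1, by simpa using hx1⟩
    have hux := hu.pos x hH
    rw [Finset.sum_filter, Finset.sum_singleton] at hle
    split_ifs at hle with h
    · have h1 : m ≤ u x := hm ▸ hmin h
      have h2 : m ^ p ≤ u x ^ p := Real.rpow_le_rpow hm0.le h1 hp0
      have h3 : c * (C * R ^ (-(2 * α))) = m ^ p / 2 := by
        rw [hc, Real.rpow_neg hR.le]; field_simp
      have h4 : 0 < m ^ p := by positivity
      rw [h3] at hle
      linarith
    · exact absurd hle (not_le.2 (Real.rpow_pos_of_pos hux p))
  have hs : (1 - ρ ^ 2) ^ α ≤ vR v e R xm := by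
    refine le_trans (Real.rpow_le_rpow hρs.le ?_ hα.le) (hv.lower _ (by linarith))
    nlinarith [norm_nonneg (xi e R xm)]
  have k1 := key xm
  rw [← hm] at k1
  have k2 : (1 - ρ ^ 2) ^ α / (2 * C) * R ^ (2 * α) * m ^ p ≤ m := by
    refine le_trans ?_ k1
    calc _ = c * (1 - ρ ^ 2) ^ α := by rw [hc]; ring
      _ ≤ _ := by gcongr
  have hmp : 0 < m ^ p := by positivity
  have k3 : m ^ p < m := by nlinarith
  have hm1 : 1 < m := by
    by_contra hcon
    have : m ^ (1:ℝ) ≤ m ^ p := Real.rpow_le_rpow_of_exponent_ge hm0 (not_lt.1 hcon) hp1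
    rw [Real.rpow_one] at this
    linarith
  have hmp1 : 1 ≤ m ^ p := Real.one_le_rpow hm1.le hp0
  have k4 := key e
  have k5 := vR_e hα hv he hR1
  have k6 : R ^ α / (2 * C) ≤ c * R ^ (-α) := by
    have e1 : R ^ (2 * α) * R ^ (-α) = R ^ α := by rw [← Real.rpow_add hR]; ring_nf
    calc R ^ α / (2 * C) ≤ m ^ p * (R ^ α / (2 * C)) := le_mul_of_one_le_left (by positivity) hmp1
      _ = _ := by rw [hc, ← e1]; ring
  have k7 : c * R ^ (-α) ≤ c * vR v e R e := by gcongr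
  linarith

/-- The balls are disjoint. -/
lemma KR_disj {e : E} (he : ‖e‖ = 1) {ρ Λ : ℝ} (hρ0 : 0 < ρ) (hρ1 : ρ < 1) (hΛ : Λ = 4 / (1 - ρ)) {j k : ℕ} {x : E}
    (hj : ‖xi e (Λ ^ j) x‖ ≤ ρ) (hk : ‖xi e (Λ ^ k) x‖ ≤ ρ) : j = k := by
  have hρ' : 0 < 1 - ρ := by linarith
  have hΛ0 : 1 ≤ Λ := by rw [hΛ, le_div_iff₀ hρ']; linarith
  have hΛp : 0 < Λ := by linarith
  have hmain : ∀ j k : ℕ, ‖xi e (Λ ^ j) x‖ ≤ ρ → ‖xi e (Λ ^ k) x‖ ≤ ρ → ¬ j < k := by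
    intro j k hj hk hjk
    have h1 := xi_norm he (pow_pos hΛp j) (hj.trans hρ1.le)
    have h2 := xi_inner he (pow_pos hΛp k) hk
    have h3 := inner_le_norm' he x
    have h4 : Λ ^ (j + 1) ≤ Λ ^ k := pow_le_pow_right₀ hΛ0 hjk
    have h5 : (1 - ρ) * Λ ^ (j + 1) = 4 * Λ ^ j := by rw [pow_succ, hΛ]; field_simp
    have h6 : (1 - ρ) * Λ ^ (j + 1) ≤ (1 - ρ) * Λ ^ k := by gcongr
    have h7 : 0 < Λ ^ j := pow_pos hΛp j
    linarith
  have a := hmain j k hj hk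
  have b := hmain k j hk hj
  omega

lemma case_neg {α p ρ C : ℝ} {v : E → ℝ} {e : E} {u : E → ℝ} (hα : 0 < α) (hα1 : α < 1) (hv : Barrier α ρ C v)
    (he : ‖e‖ = 1) (hu : SupSol α p e u) (hp0 : p < 0) (hp1 : -1 ≤ p) : False := by
  have hC := hv.C0
  have hρ0 := hv.ρ0
  have hρ1 := hv.ρ1
  have hρ' : 0 < 1 - ρ := by linarith
  obtain ⟨Λ, hΛ⟩ : ∃ Λ, Λ = 4 / (1 - ρ) := ⟨_, rfl⟩
  have hΛ1 : 1 ≤ Λ := by rw [hΛ, le_div_iff₀ hρ']; linarith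
  have hΛp : 0 < Λ := by linarith
  have hRp : ∀ k : ℕ, 0 < Λ ^ k := fun k => pow_pos hΛp k
  obtain ⟨T, hT⟩ : ∃ T, T = u e + 1 := ⟨_, rfl⟩
  have hT0 : 0 < T := by rw [hT]; linarith [hu.nonneg e]
  obtain ⟨M, hM⟩ := exists_nat_gt (T * C * (8 * T) ^ (-p))
  have hM0 : (0:ℝ) < M := lt_of_le_of_lt (by positivity) hM
  obtain ⟨ε, hε⟩ : ∃ ε, ε = T / M := ⟨_, rfl⟩
  have hε0 : 0 < ε := by rw [hε]; positivity
  have key : ∀ x, ∑ k ∈ Finset.range M, ε * (Λ ^ k) ^ α * vR v e (Λ ^ k) x ≤ u x := by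
    by_contra hcon
    push Not at hcon
    obtain ⟨x, hH, hlt, hle⟩ := barrier_cmp hv he hu (Finset.range M) (fun k => ε * (Λ ^ k) ^ α)
      (fun k => Λ ^ k) (fun k => by positivity) hRp hcon
    have hux := hu.pos x hH
    have hup : 0 < u x ^ p := Real.rpow_pos_of_pos hux p
    have hne : ((Finset.range M).filter (fun k => ‖xi e (Λ ^ k) x‖ ≤ ρ)).Nonempty := by
      rw [Finset.nonempty_iff_ne_empty]
      intro h
      rw [h, Finset.sum_empty] at hle
      linarith
    obtain ⟨j, hj⟩ := hne
    have hjx := (Finset.mem_filter.1 hj).2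
    have hs : (Finset.range M).filter (fun k => ‖xi e (Λ ^ k) x‖ ≤ ρ) = {j} := by
      ext k
      rw [Finset.mem_singleton]
      exact ⟨fun hk => KR_disj he hρ0 hρ1 hΛ (Finset.mem_filter.1 hk).2 hjx, fun hk => hk ▸ hj⟩
    rw [hs, Finset.sum_singleton] at hle
    have hRj := hRp j
    set r := Λ ^ j with hr
    have hr1 : 1 ≤ r := one_le_pow₀ hΛ1
    have hle2 : u x ^ p ≤ ε * C * r ^ (-α) := by
      refine hle.trans_eq ?_
      have : r ^ α * r ^ (-(2 * α)) = r ^ (-α) := by rw [← Real.rpow_add hRj]; ring_nf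
      rw [← this]; ring
    have hxr : ‖x‖ ≤ 2 * r := xi_norm he hRj (hjx.trans hρ1.le)
    have h4 : (4:ℝ) ^ α ≤ 4 := by
      calc (4:ℝ) ^ α ≤ 4 ^ (1:ℝ) := Real.rpow_le_rpow_of_exponent_le (by norm_num) hα1.le
        _ = 4 := Real.rpow_one _
    have hw : ∑ k ∈ Finset.range M, ε * (Λ ^ k) ^ α * vR v e (Λ ^ k) x ≤ M * (8 * ε * r ^ α) := by
      have : ∀ k ∈ Finset.range M, ε * (Λ ^ k) ^ α * vR v e (Λ ^ k) x ≤ 8 * ε * r ^ α := by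
        intro k _
        have hk := hRp k
        have h1 := vR_upper hα hv he hk x
        have h2 : (2 * ‖x‖ / Λ ^ k) ^ α ≤ (4 * r / Λ ^ k) ^ α := by
          refine Real.rpow_le_rpow (by positivity) ?_ hα.le
          exact div_le_div_of_nonneg_right (by linarith) hk.le
        rw [Real.div_rpow (x := 4 * r) (by positivity) hk.le, Real.mul_rpow (by norm_num) hRj.le] at h2
        have hkα : 0 < (Λ ^ k) ^ α := Real.rpow_pos_of_pos hk _
        calc ε * (Λ ^ k) ^ α * vR v e (Λ ^ k) x
            ≤ ε * (Λ ^ k) ^ α * (2 * (4 ^ α * r ^ α / (Λ ^ k) ^ α)) := by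
              gcongr; exact h1.trans (by linarith)
          _ = 2 * 4 ^ α * ε * r ^ α := by field_simp
          _ ≤ 2 * 4 * ε * r ^ α := by gcongr
          _ = _ := by ring
      refine (Finset.sum_le_sum this).trans_eq ?_
      simp
    have hMε : M * (8 * ε * r ^ α) = 8 * T * r ^ α := by rw [hε]; field_simp
    rw [hMε] at hw
    have hux2 : u x < 8 * T * r ^ α := hlt.trans_le hw
    have h5 : (8 * T * r ^ α) ^ p ≤ u x ^ p := Real.rpow_le_rpow_of_nonpos hux hux2.le hp0.le
    have h6 : (8 * T) ^ p * r ^ (α * p) ≤ ε * C * r ^ (-α) := by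
      rw [Real.rpow_mul hRj.le, ← Real.mul_rpow (by positivity) (by positivity)]
      exact h5.trans hle2
    have h7 : r ^ (-α) ≤ r ^ (α * p) := Real.rpow_le_rpow_of_exponent_le hr1 (by nlinarith)
    have h8 : 0 < r ^ (-α) := by positivity
    have h9 : (8 * T) ^ p ≤ ε * C := by
      have : (8 * T) ^ p * r ^ (-α) ≤ ε * C * r ^ (-α) := le_trans (by gcongr) h6
      exact le_of_mul_le_mul_right this h8
    have h10 : 1 ≤ ε * C * (8 * T) ^ (-p) := by
      calc (1:ℝ) = (8 * T) ^ p * (8 * T) ^ (-p) := by rw [← Real.rpow_add (by positivity)]; simp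
        _ ≤ _ := by gcongr
    have h11 : ε * C * (8 * T) ^ (-p) * M = T * C * (8 * T) ^ (-p) := by rw [hε]; field_simp
    nlinarith
  have k1 := key e
  have k2 : M * ε ≤ ∑ k ∈ Finset.range M, ε * (Λ ^ k) ^ α * vR v e (Λ ^ k) e := by
    have : ∑ k ∈ Finset.range M, ε ≤ ∑ k ∈ Finset.range M, ε * (Λ ^ k) ^ α * vR v e (Λ ^ k) e := by
      refine Finset.sum_le_sum fun k _ => ?_
      have h1 := vR_e hα hv he (one_le_pow₀ hΛ1 : 1 ≤ Λ ^ k)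
      have hk := hRp k
      calc ε = ε * (Λ ^ k) ^ α * (Λ ^ k) ^ (-α) := by
            rw [mul_assoc, ← Real.rpow_add hk]; simp
        _ ≤ _ := by gcongr
    simpa using this
  have k3 : M * ε = T := by rw [hε]; field_simp
  linarith
end

section
variable {E : Type*} [NormedAddCommGroup E] [InnerProductSpace ℝ E] [FiniteDimensional ℝ E]
  [MeasurableSpace E] [BorelSpace E]

lemma fatou_real {f : ℕ → E → ℝ} {g : E → ℝ} {B : ℝ} (hf : ∀ n, Integrable (f n))
    (hf0 : ∀ n x, 0 ≤ f n x) (hg : Integrable g) (hg0 : ∀ x, 0 ≤ g x) 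
    (hle : ∀ x, ∀ᶠ n in atTop, g x ≤ f n x) (hfB : ∀ n, ∫ x, f n x ≤ B) : ∫ x, g x ≤ B := by
  have hB : 0 ≤ B := (integral_nonneg (hf0 0)).trans (hfB 0)
  have h1 : ∫⁻ x, ENNReal.ofReal (g x) ≤ ENNReal.ofReal B := by
    calc ∫⁻ x, ENNReal.ofReal (g x) ≤ ∫⁻ x, liminf (fun n => ENNReal.ofReal (f n x)) atTop := by
          refine lintegral_mono fun x => ?_
          refine le_liminf_of_le (by isBoundedDefault) ?_
          filter_upwards [hle x] with n hn
          exact ENNReal.ofReal_le_ofReal hn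
      _ ≤ liminf (fun n => ∫⁻ x, ENNReal.ofReal (f n x)) atTop :=
          lintegral_liminf_le' fun n => (hf n).1.aemeasurable.ennreal_ofReal
      _ ≤ ENNReal.ofReal B := by
          refine liminf_le_of_frequently_le' (Frequently.of_forall fun n => ?_)
          rw [← ofReal_integral_eq_lintegral_ofReal (hf n) (Eventually.of_forall (hf0 n))]
          exact ENNReal.ofReal_le_ofReal (hfB n)
  rw [← ofReal_integral_eq_lintegral_ofReal hg (Eventually.of_forall hg0)] at h1
  exact (ENNReal.ofReal_le_ofReal_iff hB).1 h1

noncomputable def Lk (k : E → ℝ) (f : E → ℝ) (x : E) : ℝ := ∫ y, dlt f x y * k y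

lemma bdd_int {k f : E → ℝ} (hk : Integrable k) (hf : Continuous f) {M : ℝ} (hM : ∀ x, |f x| ≤ M)
    : Integrable (fun y => f y * k y) :=
  hk.bdd_mul hf.aestronglyMeasurable (Eventually.of_forall fun x => by simpa using hM x)

lemma dlt_int {k f : E → ℝ} (hk : Integrable k) (hf : Continuous f) {M : ℝ} (hM : ∀ x, |f x| ≤ M)
    (x : E) : Integrable (fun y => dlt f x y * k y) := by
  refine bdd_int hk (M := 4 * M) ?_ fun y => ?_
  · unfold dlt; fun_prop
  · have h1 := abs_le.1 (hM (x + y)); have h2 := abs_le.1 (hM (x - y)); have h3 := abs_le.1 (hM x)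
    unfold dlt
    rw [abs_le]; constructor <;> linarith

lemma Lk_eq {k f : E → ℝ} (hk : Integrable k) (hke : ∀ y, k (-y) = k y) (hf : Continuous f) {M : ℝ}
    (hM : ∀ x, |f x| ≤ M) (x : E) :
    Lk k f x = 2 * (∫ y, f y * k (x - y)) - 2 * (∫ y, k y) * f x := by
  have i1 : Integrable (fun y => f (x + y) * k y) := bdd_int hk (by fun_prop) fun y => hM _
  have i2 : Integrable (fun y => f (x - y) * k y) := bdd_int hk (by fun_prop) fun y => hM _
  have e1 : ∫ y, f (x - y) * k y = ∫ y, f y * k (x - y) := by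
    rw [← integral_sub_left_eq_self (fun y => f y * k (x - y)) volume x]
    simp
  have e2 : ∫ y, f (x + y) * k y = ∫ y, f (x - y) * k y := by
    rw [← integral_neg_eq_self]
    simp [hke, sub_eq_add_neg]
  have : Lk k f x = (∫ y, f (x + y) * k y) + (∫ y, f (x - y) * k y) - ∫ y, 2 * f x * k y := by
    have i3 : Integrable (fun y => f (x + y) * k y + f (x - y) * k y) := i1.add i2
    rw [← integral_add i1 i2, ← integral_sub i3 (hk.const_mul _)]
    unfold Lk dlt
    congr 1; ext y; ring
  rw [this, e2, e1, integral_const_mul]; ring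

lemma Lk_sym {k w φ : E → ℝ} (hk : Integrable k) (hke : ∀ y, k (-y) = k y) (hw : Continuous w)
    (hφ : Continuous φ) {M : ℝ} (hM : ∀ x, |w x| ≤ M) (hM' : ∀ x, |φ x| ≤ M) (hφi : Integrable φ) :
    Integrable (fun x => φ x * Lk k w x) ∧ Integrable (fun x => w x * Lk k φ x) ∧
    ∫ x, φ x * Lk k w x = ∫ x, w x * Lk k φ x := by
  have hF : Integrable (fun q : E × E => w q.1 * (φ q.2 * k (q.1 - q.2))) (volume.prod volume) := by
    refine Integrable.bdd_mul (c := M) ?_ (hw.comp continuous_fst).aestronglyMeasurable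
      (Eventually.of_forall fun x => by simpa using hM x.1)
    exact Integrable.convolution_integrand (ContinuousLinearMap.mul ℝ ℝ) hφi hk
  have i1 : Integrable (fun x => w x * ∫ y, φ y * k (x - y)) := by
    have := hF.integral_prod_left
    simpa only [integral_const_mul] using this
  have i2' := hF.integral_prod_right
  have e2 : ∀ y, ∫ x, w x * (φ y * k (x - y)) = φ y * ∫ x, w x * k (y - x) := fun y => by
    rw [← integral_const_mul]
    congr 1; ext x
    rw [← hke (y - x), neg_sub]; ring
  have i2 : Integrable (fun y => φ y * ∫ x, w x * k (y - x)) := by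
    simpa only [e2] using i2'
  have e3 : ∫ x, (w x * ∫ y, φ y * k (x - y)) = ∫ y, (φ y * ∫ x, w x * k (y - x)) := by
    have := integral_integral_swap (f := fun x y => w x * (φ y * k (x - y))) hF
    simp only [integral_const_mul, e2] at this
    exact this
  have i3 : Integrable (fun x => w x * φ x) := bdd_int hφi hw hM
  have f1 : ∀ x, φ x * Lk k w x = 2 * (φ x * ∫ y, w y * k (x - y)) - 2 * (∫ y, k y) * (w x * φ x) :=
    fun x => by rw [Lk_eq hk hke hw hM]; ring
  have f2 : ∀ x, w x * Lk k φ x = 2 * (w x * ∫ y, φ y * k (x - y)) - 2 * (∫ y, k y) * (w x * φ x) :=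
    fun x => by rw [Lk_eq hk hke hφ hM']; ring
  simp only [f1, f2]
  refine ⟨(i2.const_mul _).sub (i3.const_mul _), (i1.const_mul _).sub (i3.const_mul _), ?_⟩
  rw [integral_sub (i2.const_mul _) (i3.const_mul _), integral_sub (i1.const_mul _) (i3.const_mul _),
    integral_const_mul 2, integral_const_mul 2, e3]

noncomputable def kr (α r : ℝ) : E → ℝ := ((closedBall (0:E) r)ᶜ).indicator (kerN α)

lemma kr_int [Nontrivial E] {α r : ℝ} (hα : 0 < α) (hr : 0 < r) : Integrable (kr α r : E → ℝ) := by
  unfold kr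
  rw [integrable_indicator_iff measurableSet_closedBall.compl]
  simpa using kerN_int_large (E := E) (α := α) (a := 0) (by positivity) hr

lemma kr_even (α r : ℝ) (y : E) : kr α r (-y) = kr α r y := by
  unfold kr indicator
  simp [kerN_neg]

lemma kr_nonneg (α r : ℝ) (y : E) : 0 ≤ kr α r y :=
  indicator_nonneg (fun y _ => kerN_nonneg α y) _

lemma kr_le (α r : ℝ) (y : E) : kr α r y ≤ kerN α y :=
  indicator_le_self' (fun y _ => kerN_nonneg α y) _
end

section
variable {E : Type*} [NormedAddCommGroup E] [InnerProductSpace ℝ E] [FiniteDimensional ℝ E]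
  [MeasurableSpace E] [BorelSpace E]

lemma inf_conv {u : E → ℝ} (hu : Continuous u) (hu0 : ∀ x, 0 ≤ u x) {M l : ℝ} (hM : 0 < M)
    (hl : 0 < l) : ∃ (w : E → ℝ) (Z : E → E), Continuous w ∧ (∀ x, 0 ≤ w x) ∧ (∀ x, w x ≤ u x) ∧
      (∀ x, w x ≤ M) ∧ (∀ x, l * ‖x - Z x‖ ^ 2 ≤ M) ∧ (∀ x y, dlt w x y ≤ 2 * l * ‖y‖ ^ 2) ∧
      (∀ x y, u (Z x) ≤ M → dlt w x y ≤ dlt u (Z x) y) := by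
  set U : E → ℝ := fun z => min (u z) M with hU
  have hUc : Continuous U := hu.min continuous_const
  have hU0 : ∀ z, 0 ≤ U z := fun z => le_min (hu0 z) hM.le
  have hUu : ∀ z, U z ≤ u z := fun z => min_le_left _ _
  have hUM : ∀ z, U z ≤ M := fun z => min_le_right _ _
  have hex : ∀ x, ∃ z, ∀ z', U z + l * ‖x - z‖ ^ 2 ≤ U z' + l * ‖x - z'‖ ^ 2 := by
    intro x
    have hc : Continuous fun z => U z + l * ‖x - z‖ ^ 2 := by fun_prop
    refine hc.exists_forall_le' x ?_
    have ht : Tendsto (fun z : E => ‖x - z‖) (cocompact E) atTop := by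
      have h1 : Tendsto (fun z : E => ‖z‖ - ‖x‖) (cocompact E) atTop :=
        tendsto_atTop_add_const_right _ _ (tendsto_norm_cocompact_atTop (E := E))
      refine tendsto_atTop_mono (fun z => ?_) h1
      rw [norm_sub_rev]; exact norm_sub_norm_le z x
    filter_upwards [ht.eventually_ge_atTop (max 1 (M / l))] with z hz
    have h1 : 1 ≤ ‖x - z‖ := (le_max_left _ _).trans hz
    have h2 : M / l ≤ ‖x - z‖ := (le_max_right _ _).trans hz
    rw [div_le_iff₀ hl] at h2
    have h3 : ‖x - z‖ ≤ ‖x - z‖ ^ 2 := by nlinarith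
    have h4 := hUM x
    have h5 := hU0 z
    rw [sub_self, norm_zero]
    nlinarith
  choose Z hZ using hex
  set w : E → ℝ := fun x => U (Z x) + l * ‖x - Z x‖ ^ 2 with hw
  have hwle : ∀ x z, w x ≤ U z + l * ‖x - z‖ ^ 2 := fun x z => hZ x z
  have hwU : ∀ x, w x ≤ U x := fun x => by simpa using hwle x x
  have hw0 : ∀ x, 0 ≤ w x := fun x => add_nonneg (hU0 _) (by positivity)
  have hwd : ∀ x, l * ‖x - Z x‖ ^ 2 ≤ M := fun x => by
    have h1 := hwU x; have h2 := hUM x; have h3 := hU0 (Z x)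
    have h4 : w x = U (Z x) + l * ‖x - Z x‖ ^ 2 := rfl
    linarith
  set D := √(M / l) with hD
  have hwD : ∀ x, ‖x - Z x‖ ≤ D := fun x => by
    refine Real.le_sqrt_of_sq_le ?_
    rw [le_div_iff₀ hl]; linarith [hwd x]
  have hdiff : ∀ x y, w y - w x ≤ l * (‖y - x‖ ^ 2 + 2 * ‖y - x‖ * D) := fun x y => by
    have h1 := hwle y (Z x)
    have h2 : ‖y - Z x‖ ≤ ‖y - x‖ + ‖x - Z x‖ := by
      have : y - Z x = (y - x) + (x - Z x) := by abel
      rw [this]; exact norm_add_le _ _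
    have h3 : ‖y - Z x‖ ^ 2 ≤ (‖y - x‖ + ‖x - Z x‖) ^ 2 := by gcongr
    have h4 : w x = U (Z x) + l * ‖x - Z x‖ ^ 2 := rfl
    have h5 : ‖y - x‖ * ‖x - Z x‖ ≤ ‖y - x‖ * D := mul_le_mul_of_nonneg_left (hwD x) (norm_nonneg _)
    have h6 : ‖y - Z x‖ ^ 2 ≤ ‖x - Z x‖ ^ 2 + (‖y - x‖ ^ 2 + 2 * ‖y - x‖ * D) := by nlinarith
    have h7 := mul_le_mul_of_nonneg_left h6 hl.le
    linarith
  have hwc : Continuous w := by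
    rw [continuous_iff_continuousAt]
    intro x
    rw [ContinuousAt, tendsto_iff_norm_sub_tendsto_zero]
    have hlim : Tendsto (fun y => l * (‖y - x‖ ^ 2 + 2 * ‖y - x‖ * D)) (𝓝 x) (𝓝 0) := by
      have : Continuous fun y => l * (‖y - x‖ ^ 2 + 2 * ‖y - x‖ * D) := by fun_prop
      simpa using this.tendsto x
    refine squeeze_zero (fun y => norm_nonneg _) (fun y => ?_) hlim
    rw [Real.norm_eq_abs, abs_le]
    have h1 := hdiff x y
    have h2 := hdiff y x
    rw [norm_sub_rev] at h2
    constructor <;> linarith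
  refine ⟨w, Z, hwc, hw0, fun x => (hwU x).trans (hUu x), fun x => (hwU x).trans (hUM x), hwd, ?_, ?_⟩
  · intro x y
    have h1 := hwle (x + y) (Z x)
    have h2 := hwle (x - y) (Z x)
    have h4 : w x = U (Z x) + l * ‖x - Z x‖ ^ 2 := rfl
    have hp := parallelogram_law_with_norm ℝ (x - Z x) y
    rw [show x + y - Z x = x - Z x + y by abel] at h1
    rw [show x - y - Z x = x - Z x - y by abel] at h2
    unfold dlt
    nlinarith
  · intro x y hx
    have h1 := hwle (x + y) (Z x + y)
    have h2 := hwle (x - y) (Z x - y)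
    have h4 : w x = U (Z x) + l * ‖x - Z x‖ ^ 2 := rfl
    rw [show x + y - (Z x + y) = x - Z x by abel] at h1
    rw [show x - y - (Z x - y) = x - Z x by abel] at h2
    have h5 : U (Z x) = u (Z x) := min_eq_left hx
    have h6 := hUu (Z x + y)
    have h7 := hUu (Z x - y)
    unfold dlt
    linarith

lemma amin_int [Nontrivial E] {α M l : ℝ} (hα : 0 < α) (hα1 : α < 1) (hM : 0 < M) (hl : 0 < l) :
    Integrable (fun y : E => min (2 * l * ‖y‖ ^ 2) (2 * M) * kerN α y) := by
  have hm : Measurable (fun y : E => min (2 * l * ‖y‖ ^ 2) (2 * M) * kerN α y) := by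
    refine Measurable.mul ?_ (kerN_meas α)
    fun_prop
  have h0 : ∀ y : E, 0 ≤ min (2 * l * ‖y‖ ^ 2) (2 * M) := fun y => le_min (by positivity) (by positivity)
  rw [← integrableOn_univ, ← union_compl_self (closedBall (0:E) 1)]
  refine IntegrableOn.union ?_ ?_
  · refine Integrable.mono' ((kerN_int_small (E := E) (α := α) (a := 2) (ρ := 1) (by linarith)
      one_pos).const_mul (2 * l)) hm.aestronglyMeasurable
      (Eventually.of_forall fun y => ?_)
    rw [Real.norm_eq_abs, abs_of_nonneg (mul_nonneg (h0 y) (kerN_nonneg α y)), ← mul_assoc, Real.rpow_two]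
    exact mul_le_mul_of_nonneg_right (min_le_left _ _) (kerN_nonneg α y)
  · refine Integrable.mono' ((kerN_int_large (E := E) (α := α) (a := 0) (ρ := 1) (by linarith)
      one_pos).const_mul (2 * M)) hm.aestronglyMeasurable
      (Eventually.of_forall fun y => ?_)
    rw [Real.norm_eq_abs, abs_of_nonneg (mul_nonneg (h0 y) (kerN_nonneg α y)), ← mul_assoc, Real.rpow_zero, mul_one]
    exact mul_le_mul_of_nonneg_right (min_le_right _ _) (kerN_nonneg α y)

/-- truncated laplacian of the cut barrier -/
lemma cut_lower [Nontrivial E] {α ρ C R η r0 : ℝ} {v : E → ℝ} {e : E} (hα : 0 < α)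
    (hv : Barrier α ρ C v) (hR : 0 < R) (hη : 0 < η)
    (hr0 : cthickening r0 {x | η ≤ vR v e R x} ⊆ {x | ‖xi e R x‖ < 1}) {r : ℝ} (hr : 0 < r)
    (hrr : r ≤ r0) (x : E) :
    -({x : E | ‖xi e R x‖ ≤ ρ}.indicator (fun _ => C * R ^ (-(2 * α))) x) ≤
      Lk (kr α r) (fun x => max (vR v e R x - η) 0) x := by
  set φ : E → ℝ := fun x => max (vR v e R x - η) 0 with hφ
  have hC := hv.C0
  have hVc : Continuous (vR v e R) := hv.cont.comp (xi_cont e R)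
  have hV2 : ∀ x, |vR v e R x| ≤ 2 := fun x => by
    rw [abs_of_nonneg (show 0 ≤ vR v e R x from hv.nonneg _)]
    rcases le_or_gt ‖xi e R x‖ 1 with h | h
    · refine (hv.upper _ h).trans ?_
      have : (1 - ‖xi e R x‖ ^ 2) ^ α ≤ 1 :=
        Real.rpow_le_one (by nlinarith [norm_nonneg (xi e R x)]) (by nlinarith [norm_nonneg (xi e R x)]) hα.le
      linarith
    · rw [vR, hv.zero _ h.le]; norm_num
  have hφc : Continuous φ := (hVc.sub continuous_const).max continuous_const
  have hφ2 : ∀ x, |φ x| ≤ 2 := fun x => by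
    rw [abs_of_nonneg (le_max_right _ _)]
    exact max_le (by linarith [(abs_le.1 (hV2 x)).2]) (by norm_num)
  have hind0 : 0 ≤ {x : E | ‖xi e R x‖ ≤ ρ}.indicator (fun _ => C * R ^ (-(2 * α))) x :=
    indicator_nonneg (fun _ _ => by positivity) _
  rcases le_or_gt (vR v e R x) η with h | h
  · have h1 : φ x = 0 := max_eq_right (by linarith)
    have h2 : 0 ≤ Lk (kr α r) φ x := integral_nonneg fun y => by
      refine mul_nonneg ?_ (kr_nonneg _ _ _)
      have a : 0 ≤ φ (x + y) := le_max_right _ _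
      have b : 0 ≤ φ (x - y) := le_max_right _ _
      unfold dlt; rw [h1]; linarith
    linarith
  · have hxS : x ∈ {x | η ≤ vR v e R x} := h.le
    have hball : ∀ z, dist z x ≤ r0 → ‖xi e R z‖ < 1 := fun z hz =>
      hr0 (mem_cthickening_of_dist_le z x r0 _ hxS hz)
    have hx1 : ‖xi e R x‖ < 1 := hball x (by rw [dist_self]; linarith)
    have h1 : φ x = vR v e R x - η := max_eq_left (by linarith)
    have hintv := int_vR hR (hv.int _ hx1)
    have h2 : ∫ y, dlt (vR v e R) x y * kerN α y ≤ Lk (kr α r) φ x := by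
      refine integral_mono hintv (dlt_int (kr_int hα hr) hφc hφ2 x) fun y => ?_
      by_cases hy : ‖y‖ ≤ r
      · have : kr α r y = 0 := indicator_of_notMem (by simpa using hy) _
        simp only [this, mul_zero]
        refine mul_nonpos_of_nonpos_of_nonneg ?_ (kerN_nonneg α y)
        rw [dlt_vR]
        have e1 : xi e R x + R⁻¹ • y = xi e R (x + y) := by simp only [xi, smul_add]; abel
        have e2 : xi e R x - R⁻¹ • y = xi e R (x - y) := by simp only [xi, smul_sub]; abel
        refine hv.conc _ _ ?_ ?_
        · rw [e1]; exact (hball _ (by rw [dist_eq_norm]; simpa using hy.trans hrr)).le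
        · rw [e2]; exact (hball _ (by rw [dist_eq_norm]; simpa using hy.trans hrr)).le
      · have : kr α r y = kerN α y := indicator_of_mem (by simpa using hy) _
        simp only [this]
        refine mul_le_mul_of_nonneg_right ?_ (kerN_nonneg α y)
        have a : vR v e R (x + y) - η ≤ φ (x + y) := le_max_left _ _
        have b : vR v e R (x - y) - η ≤ φ (x - y) := le_max_left _ _
        unfold dlt; rw [h1]; linarith
    refine le_trans ?_ h2
    rw [lap_vR hR]
    have hRp : 0 < R ^ (-(2 * α)) := Real.rpow_pos_of_pos hR _
    by_cases hρ : ‖xi e R x‖ ≤ ρ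
    · rw [indicator_of_mem (show x ∈ {x : E | ‖xi e R x‖ ≤ ρ} from hρ)]
      have := mul_le_mul_of_nonneg_left (hv.lap _ hx1) hRp.le
      linarith
    · rw [indicator_of_notMem (show x ∉ {x : E | ‖xi e R x‖ ≤ ρ} from hρ), neg_zero]
      exact mul_nonneg hRp.le (hv.lap' _ hx1 (not_le.1 hρ))
end

section
variable {E : Type*} [NormedAddCommGroup E] [InnerProductSpace ℝ E] [FiniteDimensional ℝ E]
  [MeasurableSpace E] [BorelSpace E]

lemma kr_mul (α r : ℝ) (f : E → ℝ) :
    (fun y => f y * kr α r y) = ((closedBall (0:E) r)ᶜ).indicator (fun y => f y * kerN α y) := by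
  ext y
  unfold kr indicator
  split_ifs <;> simp

lemma kr_mul_int {α r : ℝ} {f : E → ℝ} (hf : Integrable (fun y => f y * kerN α y)) :
    Integrable (fun y => f y * kr α r y) := by
  rw [kr_mul]
  exact hf.indicator measurableSet_closedBall.compl

lemma trunc_tendsto {α r0 : ℝ} {u : E → ℝ} {z : E} 
    (hi : Integrable (fun y => dlt u z y * kerN α y)) :
    Tendsto (fun n : ℕ => Lk (kr α (r0 / ((n:ℝ) + 1))) u z) atTop (𝓝 (∫ y, dlt u z y * kerN α y)) := by
  unfold Lk
  refine tendsto_integral_of_dominated_convergence (fun y => ‖dlt u z y * kerN α y‖)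
    (fun n => (kr_mul_int hi).1) hi.norm (fun n => Eventually.of_forall fun y => ?_)
    (Eventually.of_forall fun y => ?_)
  · rw [norm_mul, norm_mul, Real.norm_of_nonneg (kr_nonneg _ _ _), Real.norm_of_nonneg (kerN_nonneg _ _)]
    exact mul_le_mul_of_nonneg_left (kr_le _ _ _) (norm_nonneg _)
  · by_cases hy : y = 0
    · simp [hy, dlt, two_mul]
    · have h1 : Tendsto (fun n : ℕ => r0 / ((n:ℝ) + 1)) atTop (𝓝 0) :=
        tendsto_const_div_atTop_nhds_zero_nat r0 |>.comp (tendsto_add_atTop_nat 1) |>.congr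
          (fun n => by simp)
      refine tendsto_const_nhds.congr' ?_
      filter_upwards [h1.eventually_lt_const (norm_pos_iff.2 hy)] with n hn
      rw [kr, indicator_of_mem]
      simpa using hn

lemma weak_ineq [Nontrivial E] {α p ρ C R η : ℝ} {v : E → ℝ} {e : E} {u : E → ℝ} (hα : 0 < α) (hα1 : α < 1)
    (hv : Barrier α ρ C v) (he : ‖e‖ = 1) (hu : SupSol α p e u) (hp : 0 < p) (hR : 0 < R) (hη : 0 < η) :
    Integrable (fun x => max (vR v e R x - η) 0 * u x ^ p) ∧ ∫ x, max (vR v e R x - η) 0 * u x ^ p ≤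
      C * R ^ (-(2 * α)) * ∫ x in {x : E | ‖xi e R x‖ ≤ ρ}, u x := by
  have hVc : Continuous (vR v e R) := hv.cont.comp (xi_cont e R)
  set φ : E → ℝ := fun x => max (vR v e R x - η) 0 with hφ
  have hφc : Continuous φ := (hVc.sub continuous_const).max continuous_const
  have hφ0 : ∀ x, 0 ≤ φ x := fun x => le_max_right _ _
  have hV2 : ∀ x, vR v e R x ≤ 2 := fun x => by
    rcases le_or_gt ‖xi e R x‖ 1 with h | h
    · refine (hv.upper _ h).trans ?_
      have : (1 - ‖xi e R x‖ ^ 2) ^ α ≤ 1 :=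
        Real.rpow_le_one (by nlinarith [norm_nonneg (xi e R x)]) (by nlinarith [norm_nonneg (xi e R x)]) hα.le
      linarith
    · rw [vR, hv.zero _ h.le]; norm_num
  have hφ2 : ∀ x, φ x ≤ 2 := fun x => max_le (by linarith [hV2 x]) (by norm_num)
  set S : Set E := {x | η ≤ vR v e R x} with hSdef
  have hSB : S ⊆ {x | ‖xi e R x‖ < 1} := fun x hx => by
    by_contra h
    have h1 : vR v e R x = 0 := hv.zero _ (not_lt.1 h)
    have h2 : η ≤ vR v e R x := hx
    linarith
  have hSc : IsCompact S := (KR_compact e R 1 hR).of_isClosed_subset (isClosed_le continuous_const hVc)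
    fun x hx => le_of_lt (show ‖xi e R x‖ < 1 from hSB hx)
  have hBo : IsOpen {x : E | ‖xi e R x‖ < 1} := isOpen_lt (xi_cont e R).norm continuous_const
  obtain ⟨r0, hr0, hsub⟩ := hSc.exists_cthickening_subset_open hBo hSB
  have hS'c : IsCompact (cthickening r0 S) := hSc.cthickening
  obtain ⟨M0, hM0⟩ := hS'c.bddAbove_image hu.cont.continuousOn
  set M := max M0 2 with hMdef
  have hM2 : 2 ≤ M := le_max_right _ _
  have hMp : 0 < M := by linarith
  have hSM : ∀ z ∈ cthickening r0 S, u z ≤ M := fun z hz =>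
    (hM0 (mem_image_of_mem _ hz)).trans (le_max_left _ _)
  have hφS : ∀ x, x ∉ S → φ x = 0 := fun x hx => max_eq_right (by
    have : vR v e R x < η := not_le.1 hx
    linarith)
  have hφs : HasCompactSupport φ := HasCompactSupport.intro hSc hφS
  have hφi : Integrable φ := hφc.integrable_of_hasCompactSupport hφs
  have hupc : Continuous (fun x => u x ^ p) := hu.cont.rpow_const fun x => Or.inr hp.le
  have hφui : Integrable (fun x => φ x * u x ^ p) :=
    (hφc.mul hupc).integrable_of_hasCompactSupport hφs.mul_right
  have hI0 : 0 ≤ ∫ x, φ x := integral_nonneg hφ0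
  have hKm : MeasurableSet {x : E | ‖xi e R x‖ ≤ ρ} := (KR_compact e R ρ hR).measurableSet
  have hKi : IntegrableOn u {x : E | ‖xi e R x‖ ≤ ρ} :=
    hu.cont.continuousOn.integrableOn_compact (KR_compact e R ρ hR)
  refine ⟨hφui, ?_⟩
  suffices H : ∀ τ > 0, ∫ x, φ x * u x ^ p ≤ τ * (∫ x, φ x) +
      C * R ^ (-(2 * α)) * ∫ x in {x : E | ‖xi e R x‖ ≤ ρ}, u x by
    refine le_of_forall_pos_le_add fun ε hε => ?_
    have h1 := H (ε / ((∫ x, φ x) + 1)) (by positivity)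
    have h2 : ε / ((∫ x, φ x) + 1) * (∫ x, φ x) ≤ ε := by
      rw [div_mul_eq_mul_div, div_le_iff₀ (by positivity)]
      nlinarith
    linarith
  intro τ hτ
  obtain ⟨d1, hd1, hd1'⟩ := Metric.uniformContinuousOn_iff.1
    (hS'c.uniformContinuousOn_of_continuous hupc.continuousOn) (τ / 2) (by positivity)
  set d := min (d1 / 2) r0 with hd
  have hd0 : 0 < d := lt_min (by positivity) hr0
  have hdr : d ≤ r0 := min_le_right _ _
  have hdd : d < d1 := (min_le_left _ _).trans_lt (by linarith)
  have hl : 0 < M / d ^ 2 := by positivity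
  obtain ⟨w, Z, hwc, hw0, hwu, hwM, hZ, hw1, hw2⟩ := inf_conv hu.cont hu.nonneg hMp hl
  have hZd : ∀ x, ‖x - Z x‖ ≤ d := fun x => by
    have h := hZ x
    rw [div_mul_eq_mul_div, div_le_iff₀ (by positivity)] at h
    exact le_of_sq_le_sq (le_of_mul_le_mul_left h hMp) hd0.le
  have hAi := amin_int (E := E) hα hα1 hMp hl
  set A := ∫ y : E, min (2 * (M / d ^ 2) * ‖y‖ ^ 2) (2 * M) * kerN α y with hA
  have hwa : ∀ x, |w x| ≤ M := fun x => by rw [abs_of_nonneg (hw0 x)]; exact hwM x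
  have hφa : ∀ x, |φ x| ≤ M := fun x => by rw [abs_of_nonneg (hφ0 x)]; linarith [hφ2 x]
  have hrn : ∀ n : ℕ, 0 < r0 / ((n:ℝ) + 1) := fun n => by positivity
  have hrn' : ∀ n : ℕ, r0 / ((n:ℝ) + 1) ≤ r0 := fun n => div_le_self hr0.le (by linarith [Nat.cast_nonneg (α := ℝ) n])
  have hA0 : 0 ≤ A := integral_nonneg fun y => mul_nonneg (le_min (by positivity) (by positivity)) (kerN_nonneg _ _)
  have hLA : ∀ n : ℕ, ∀ x, Lk (kr α (r0 / ((n:ℝ) + 1))) w x ≤ A := fun n x => by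
    refine integral_mono (dlt_int (kr_int hα (hrn n)) hwc hwa x) hAi fun y => ?_
    have h1 : dlt w x y ≤ min (2 * (M / d ^ 2) * ‖y‖ ^ 2) (2 * M) := by
      refine le_min (hw1 x y) ?_
      unfold dlt
      linarith [hwM (x + y), hwM (x - y), hw0 x]
    exact (mul_le_mul_of_nonneg_right h1 (kr_nonneg _ _ _)).trans
      (mul_le_mul_of_nonneg_left (kr_le _ _ _) (le_min (by positivity) (by positivity)))
  have hsym := fun n : ℕ => Lk_sym (kr_int (E := E) hα (hrn n)) (kr_even _ _) hwc hφc hwa hφa hφi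
  have key := fatou_real (f := fun (n : ℕ) x => φ x * (A + τ) - φ x * Lk (kr α (r0 / ((n:ℝ) + 1))) w x)
    (g := fun x => φ x * A + φ x * u x ^ p)
    (B := (∫ x, φ x) * (A + τ) + C * R ^ (-(2 * α)) * ∫ x in {x : E | ‖xi e R x‖ ≤ ρ}, u x)
    (fun n => (hφi.mul_const _).sub (hsym n).1) ?_ ((hφi.mul_const _).add hφui) ?_ ?_ ?_
  · rw [integral_add (hφi.mul_const _) hφui, integral_mul_const] at key
    linarith
  · intro n x
    have := mul_le_mul_of_nonneg_left (hLA n x) (hφ0 x)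
    have := mul_nonneg (hφ0 x) hτ.le
    linarith
  · intro x
    have := mul_nonneg (hφ0 x) hA0
    have := mul_nonneg (hφ0 x) (Real.rpow_nonneg (hu.nonneg x) p)
    linarith
  · intro x
    by_cases hx : x ∈ S
    · have hxS' : x ∈ cthickening r0 S := self_subset_cthickening S hx
      have hzS' : Z x ∈ cthickening r0 S :=
        mem_cthickening_of_dist_le (Z x) x r0 _ hx (by
          rw [dist_comm, dist_eq_norm]; exact (hZd x).trans hdr)
      have hzp : 0 < inner ℝ e (Z x) := xi_pos he hR (hsub hzS')
      have ht := trunc_tendsto (r0 := r0) (hu.int _ hzp)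
      have hd' := hd1' x hxS' (Z x) hzS' (by rw [dist_eq_norm]; exact (hZd x).trans_lt hdd)
      rw [Real.dist_eq] at hd'
      have h3 := (abs_lt.1 hd').2
      have h4 := hu.ineq _ hzp
      filter_upwards [ht.eventually_lt_const (show (∫ y, dlt u (Z x) y * kerN α y) < - u x ^ p + τ by linarith)] with n hn
      have h5 : Lk (kr α (r0 / ((n:ℝ) + 1))) w x ≤ Lk (kr α (r0 / ((n:ℝ) + 1))) u (Z x) :=
        integral_mono (dlt_int (kr_int hα (hrn n)) hwc hwa x) (kr_mul_int (hu.int _ hzp)) fun y =>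
          mul_le_mul_of_nonneg_right (hw2 x y (hSM _ hzS')) (kr_nonneg _ _ _)
      have := mul_le_mul_of_nonneg_left (h5.trans hn.le) (hφ0 x)
      linarith
    · simp [hφS x hx]
  · intro n
    rw [integral_sub (hφi.mul_const _) (hsym n).1, integral_mul_const, (hsym n).2.2]
    have h1 : ∫ x, -({x : E | ‖xi e R x‖ ≤ ρ}.indicator (fun x => C * R ^ (-(2 * α)) * u x) x) ≤
        ∫ x, w x * Lk (kr α (r0 / ((n:ℝ) + 1))) φ x := by
      refine integral_mono ?_ (hsym n).2.1 fun x => ?_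
      · exact ((integrable_indicator_iff hKm).2 (hKi.const_mul _)).neg
      · have h2 := cut_lower hα hv hR hη hsub (hrn n) (hrn' n) x
        have h3 := mul_le_mul_of_nonneg_left h2 (hw0 x)
        refine le_trans ?_ h3
        have hC := hv.C0
        by_cases hx : x ∈ {x : E | ‖xi e R x‖ ≤ ρ}
        · simp only [indicator_of_mem hx]
          have : 0 ≤ C * R ^ (-(2 * α)) := by positivity
          nlinarith [hwu x]
        · simp [indicator_of_notMem hx]
    rw [integral_neg, integral_indicator hKm, integral_const_mul] at h1
    linarith
end

lemma seq_contra {j : ℕ → ℝ} {D p : ℝ} (hj : ∀ n, 0 < j n) (hD : 0 < D) (hp : 1 < p)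
    (h : ∀ n, ∑ k ∈ Finset.range (n + 1), j k ≤ D * j n ^ (1 / p)) : False := by
  have hp0 : 0 < p := by linarith
  have hinv : ∀ n, (j n ^ (1 / p)) ^ p = j n := fun n => by
    rw [← Real.rpow_mul (hj n).le, one_div_mul_cancel hp0.ne', Real.rpow_one]
  have hle : ∀ n k, k ≤ n → j k ≤ D * j n ^ (1 / p) := fun n k hk =>
    (Finset.single_le_sum (f := j) (fun i _ => (hj i).le) (Finset.mem_range.2 (by omega))).trans (h n)
  have hlow : ∀ n, (j 0 / D) ^ p ≤ j n := fun n => by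
    rw [← hinv n]
    refine Real.rpow_le_rpow (div_nonneg (hj 0).le hD.le) ?_ hp0.le
    rw [div_le_iff₀ hD, mul_comm]
    exact hle n 0 (Nat.zero_le _)
  set B := (D ^ p) ^ (1 / (p - 1)) with hB
  have hup : ∀ n, j n ≤ B := fun n => by
    have h1 : j n ^ p ≤ D ^ p * j n := by
      calc j n ^ p ≤ (D * j n ^ (1 / p)) ^ p := Real.rpow_le_rpow (hj n).le (hle n n le_rfl) hp0.le
        _ = _ := by rw [Real.mul_rpow hD.le (Real.rpow_nonneg (hj n).le _), hinv]
    have h2 : j n ^ (p - 1) ≤ D ^ p := by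
      rw [Real.rpow_sub_one (hj n).ne', div_le_iff₀ (hj n)]; exact h1
    have h3 : (j n ^ (p - 1)) ^ (1 / (p - 1)) = j n := by
      rw [← Real.rpow_mul (hj n).le, mul_one_div_cancel (by linarith), Real.rpow_one]
    rw [← h3]
    exact Real.rpow_le_rpow (Real.rpow_nonneg (hj n).le _) h2 (by
      have : 0 < p - 1 := by linarith
      positivity)
  have hm : 0 < (j 0 / D) ^ p := Real.rpow_pos_of_pos (div_pos (hj 0) hD) _
  obtain ⟨n, hn⟩ := exists_nat_gt (D * B ^ (1 / p) / (j 0 / D) ^ p)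
  rw [div_lt_iff₀ hm] at hn
  have h1 : (n + 1 : ℕ) * (j 0 / D) ^ p ≤ ∑ k ∈ Finset.range (n + 1), j k := by
    have := Finset.card_nsmul_le_sum (Finset.range (n + 1)) j _ (fun k _ => hlow k)
    simpa using this
  have h2 : j n ^ (1 / p) ≤ B ^ (1 / p) := Real.rpow_le_rpow (hj n).le (hup n) (by positivity)
  have h3 := h n
  have h4 := mul_le_mul_of_nonneg_left h2 hD.le
  push_cast at h1
  nlinarith

section
variable {E : Type*} [NormedAddCommGroup E] [InnerProductSpace ℝ E] [FiniteDimensional ℝ E]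
  [MeasurableSpace E] [BorelSpace E]

lemma vR_low {α ρ C R R' : ℝ} {v : E → ℝ} {e : E} (hα : 0 < α) (hv : Barrier α ρ C v) (he : ‖e‖ = 1)
    (hR' : 0 < R') (hR : 0 < R) (h : R' = R ∨ 4 / (1 - ρ) * R' ≤ R) {x : E} (hx : ‖xi e R' x‖ ≤ ρ) :
    (1 - ρ) ^ α * (R' / R) ^ α ≤ vR v e R x := by
  have hρ0 := hv.ρ0
  have hρ1 := hv.ρ1
  have h1 : (1 - ρ) * (R' / R) ≤ 1 - ‖xi e R x‖ ^ 2 := by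
    rcases h with rfl | h
    · rw [div_self hR.ne']
      nlinarith [norm_nonneg (xi e R' x)]
    · exact xi_sq_ge he hR' hρ1 h hx
  have h2 : 0 < (1 - ρ) * (R' / R) := mul_pos (by linarith) (by positivity)
  have h3 : ‖xi e R x‖ ≤ 1 := by nlinarith [norm_nonneg (xi e R x)]
  rw [← Real.mul_rpow (by linarith) (by positivity)]
  exact (Real.rpow_le_rpow h2.le h1 hα.le).trans (hv.lower _ h3)

lemma sum_ineq [Nontrivial E] {α p ρ C Λ : ℝ} {v : E → ℝ} {e : E} {u : E → ℝ} (hα : 0 < α) (hα1 : α < 1)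
    (hv : Barrier α ρ C v) (he : ‖e‖ = 1) (hu : SupSol α p e u) (hp : 0 < p) (hΛ : Λ = 4 / (1 - ρ)) (n : ℕ) :
    ∑ k ∈ Finset.range (n + 1), (1 - ρ) ^ α / 2 * (Λ ^ k / Λ ^ n) ^ α *
      (∫ x in {x : E | ‖xi e (Λ ^ k) x‖ ≤ ρ}, u x ^ p) ≤
    C * (Λ ^ n) ^ (-(2 * α)) * ∫ x in {x : E | ‖xi e (Λ ^ n) x‖ ≤ ρ}, u x := by
  have hρ0 := hv.ρ0
  have hρ1 := hv.ρ1
  have hρ' : 0 < 1 - ρ := by linarith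
  have hΛ1 : 1 ≤ Λ := by rw [hΛ, le_div_iff₀ hρ']; linarith
  have hΛp : 0 < Λ := by linarith
  have hRp : ∀ k : ℕ, 0 < Λ ^ k := fun k => pow_pos hΛp k
  set a := (1 - ρ) ^ α / 2 with ha
  have ha0 : 0 < a := by positivity
  have hη : 0 < a * (1 / Λ ^ n) ^ α := by have := hRp n; positivity
  obtain ⟨hi, hw⟩ := weak_ineq hα hα1 hv he hu hp (hRp n) hη
  refine le_trans ?_ hw
  have hupc : Continuous (fun x => u x ^ p) := hu.cont.rpow_const fun x => Or.inr hp.le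
  have hKm : ∀ k : ℕ, MeasurableSet {x : E | ‖xi e (Λ ^ k) x‖ ≤ ρ} := fun k => (KR_compact e _ ρ (hRp k)).measurableSet
  have hKi : ∀ k : ℕ, IntegrableOn (fun x => a * (Λ ^ k / Λ ^ n) ^ α * u x ^ p) {x : E | ‖xi e (Λ ^ k) x‖ ≤ ρ} := fun k =>
    (hupc.continuousOn.integrableOn_compact (KR_compact e _ ρ (hRp k))).const_mul _
  have hKi' : ∀ k : ℕ, Integrable ({x : E | ‖xi e (Λ ^ k) x‖ ≤ ρ}.indicator (fun x => a * (Λ ^ k / Λ ^ n) ^ α * u x ^ p)) :=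
    fun k => (integrable_indicator_iff (hKm k)).2 (hKi k)
  have e1 : ∀ k : ℕ, a * (Λ ^ k / Λ ^ n) ^ α * (∫ x in {x : E | ‖xi e (Λ ^ k) x‖ ≤ ρ}, u x ^ p) =
      ∫ x, {x : E | ‖xi e (Λ ^ k) x‖ ≤ ρ}.indicator (fun x => a * (Λ ^ k / Λ ^ n) ^ α * u x ^ p) x := fun k => by
    rw [integral_indicator (hKm k), integral_const_mul]
  simp only [e1]
  rw [← integral_finsetSum _ fun k _ => hKi' k]
  refine integral_mono (integrable_finsetSum _ fun k _ => hKi' k) hi fun x => ?_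
  have hup : 0 ≤ u x ^ p := Real.rpow_nonneg (hu.nonneg x) p
  dsimp only
  by_cases hx : ∃ k ∈ Finset.range (n + 1), ‖xi e (Λ ^ k) x‖ ≤ ρ
  · obtain ⟨k, hk, hkx⟩ := hx
    rw [Finset.sum_eq_single_of_mem k hk fun b _ hb => indicator_of_notMem
      (show x ∉ {x : E | ‖xi e (Λ ^ b) x‖ ≤ ρ} from fun hbx => hb (KR_disj he hρ0 hρ1 hΛ hbx hkx)) _,
      indicator_of_mem (show x ∈ {x : E | ‖xi e (Λ ^ k) x‖ ≤ ρ} from hkx)]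
    refine mul_le_mul_of_nonneg_right ?_ hup
    refine le_trans ?_ (le_max_left _ _)
    have hkn : k ≤ n := by have := Finset.mem_range.1 hk; omega
    have h1 := vR_low hα hv he (hRp k) (hRp n) (by
      rcases hkn.eq_or_lt with h | h
      · left; rw [h]
      · right; rw [← hΛ, ← pow_succ']; exact pow_le_pow_right₀ hΛ1 h) hkx
    have h2 : (1 / Λ ^ n) ^ α ≤ (Λ ^ k / Λ ^ n) ^ α := by
      have := hRp n
      refine Real.rpow_le_rpow (by positivity) ?_ hα.le
      exact div_le_div_of_nonneg_right (one_le_pow₀ hΛ1) (hRp n).le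
    have h3 := mul_le_mul_of_nonneg_left h2 ha0.le
    have h4 : (1 - ρ) ^ α = 2 * a := by rw [ha]; ring
    rw [h4] at h1
    linarith
  · push Not at hx
    rw [Finset.sum_eq_zero fun k hk => indicator_of_notMem
      (show x ∉ {x : E | ‖xi e (Λ ^ k) x‖ ≤ ρ} from fun h => absurd h (not_le.2 (hx k hk))) _]
    exact mul_nonneg (le_max_right _ _) hup

lemma J_pos {α p ρ R : ℝ} {e : E} {u : E → ℝ} (he : ‖e‖ = 1) (hu : SupSol α p e u) (hp : 0 < p)
    (hR : 0 < R) (hρ0 : 0 < ρ) (hρ1 : ρ < 1) : 0 < ∫ x in {x : E | ‖xi e R x‖ ≤ ρ}, u x ^ p := by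
  have hupc : Continuous (fun x => u x ^ p) := hu.cont.rpow_const fun x => Or.inr hp.le
  have hK := KR_compact e R ρ hR
  rw [setIntegral_pos_iff_support_of_nonneg_ae
    (Eventually.of_forall fun x => Real.rpow_nonneg (hu.nonneg x) p) (hupc.continuousOn.integrableOn_compact hK)]
  have hO : IsOpen {x : E | ‖xi e R x‖ < ρ} := isOpen_lt (xi_cont e R).norm continuous_const
  refine (hO.measure_pos volume ⟨R • e, by simp [KR_center e hR, hρ0]⟩).trans_le (measure_mono fun x hx => ?_)
  have hx' : ‖xi e R x‖ < ρ := hx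
  exact ⟨(Real.rpow_pos_of_pos (hu.pos x (xi_pos he hR (hx'.trans hρ1))) p).ne', hx'.le⟩

lemma holder_K {α p ρ R : ℝ} {e : E} {u : E → ℝ} (he : ‖e‖ = 1) (hu : SupSol α p e u) (hp : 1 < p)
    (hR : 0 < R) (hρ0 : 0 < ρ) (hρ1 : ρ < 1) :
    ∫ x in {x : E | ‖xi e R x‖ ≤ ρ}, u x ≤
      (volume.real (closedBall (0:E) 2) + 1) * (R ^ ((Module.finrank ℝ E : ℝ) * (1 - 1 / p)) *
        (∫ x in {x : E | ‖xi e R x‖ ≤ ρ}, u x ^ p) ^ (1 / p)) := by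
  have hp0 : 0 < p := by linarith
  have hupc : Continuous (fun x => u x ^ p) := hu.cont.rpow_const fun x => Or.inr hp0.le
  have hK := KR_compact e R ρ hR
  have hJ := J_pos he hu hp0 hR hρ0 hρ1
  set K := {x : E | ‖xi e R x‖ ≤ ρ} with hKd
  set J := ∫ x in K, u x ^ p with hJd
  set d : ℝ := (Module.finrank ℝ E : ℝ) with hd
  set c := volume.real (closedBall (0:E) 2) with hc
  have hvol : volume.real K ≤ R ^ d * c := by
    have h1 : K ⊆ closedBall (0:E) (R * 2) := fun x hx => by
      have := xi_norm he hR ((show ‖xi e R x‖ ≤ ρ from hx).trans hρ1.le)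
      simp; linarith
    refine (measureReal_mono h1 measure_closedBall_lt_top.ne).trans_eq ?_
    rw [hc, measureReal_def, measureReal_def, Measure.addHaar_closedBall_mul_of_pos volume 0 hR,
      ENNReal.toReal_mul, ENNReal.toReal_ofReal (by positivity), hd, Real.rpow_natCast]
  have hRd : 0 < R ^ d := Real.rpow_pos_of_pos hR _
  set t := (J / R ^ d) ^ (1 / p) with ht
  have ht0 : 0 < t := Real.rpow_pos_of_pos (div_pos hJ hRd) _
  have h1 : ∫ x in K, u x ≤ ∫ x in K, (t + t ^ (1 - p) * u x ^ p) := by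
    refine integral_mono (hu.cont.continuousOn.integrableOn_compact hK)
      ((by fun_prop : Continuous fun x => t + t ^ (1 - p) * u x ^ p).continuousOn.integrableOn_compact hK) fun x => ?_
    dsimp only
    have hx0 := Real.rpow_nonneg (hu.nonneg x) p
    have ht1 : 0 < t ^ (1 - p) := Real.rpow_pos_of_pos ht0 _
    rcases le_or_gt (u x) t with h | h
    · have := mul_nonneg ht1.le hx0
      linarith
    · have hx : 0 < u x := ht0.trans h
      have h2 : u x ^ p = u x * u x ^ (p - 1) := by rw [Real.rpow_sub_one hx.ne']; field_simp
      have h3 : t ^ (p - 1) ≤ u x ^ (p - 1) := Real.rpow_le_rpow ht0.le h.le (by linarith)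
      have h4 : t ^ (1 - p) * t ^ (p - 1) = 1 := by rw [← Real.rpow_add ht0]; simp
      have h5 : u x * 1 ≤ u x * (t ^ (1 - p) * u x ^ (p - 1)) := by
        refine mul_le_mul_of_nonneg_left ?_ hx.le
        exact h4.symm.le.trans (mul_le_mul_of_nonneg_left h3 ht1.le)
      rw [h2]
      linarith
  have h2 : ∫ x in K, (t + t ^ (1 - p) * u x ^ p) = volume.real K * t + t ^ (1 - p) * J := by
    have hti : IntegrableOn (fun _ : E => t) K := continuousOn_const.integrableOn_compact hK
    rw [integral_add hti
      ((hupc.continuousOn.integrableOn_compact hK).const_mul _), integral_const_mul, setIntegral_const, smul_eq_mul]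
  have hs : R ^ d * t = R ^ (d * (1 - 1 / p)) * J ^ (1 / p) := by
    rw [ht, Real.div_rpow hJ.le hRd.le, ← Real.rpow_mul hR.le, mul_sub, Real.rpow_sub hR, mul_one]
    ring
  have hs2 : t ^ (1 - p) * J = R ^ d * t := by
    have : t ^ p = J / R ^ d := by
      rw [ht, ← Real.rpow_mul (div_pos hJ hRd).le, one_div_mul_cancel hp0.ne', Real.rpow_one]
    rw [Real.rpow_sub ht0, Real.rpow_one, this]
    field_simp
  rw [← hs]
  calc _ ≤ _ := h1
    _ = _ := h2
    _ ≤ R ^ d * c * t + R ^ d * t := by rw [hs2]; gcongr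
    _ = _ := by ring

lemma case_big [Nontrivial E] {α p ρ C : ℝ} {v : E → ℝ} {e : E} {u : E → ℝ} (hα : 0 < α) (hα1 : α < 1)
    (hv : Barrier α ρ C v) (he : ‖e‖ = 1) (hu : SupSol α p e u) (hp : 1 < p)
    (hp2 : p * ((Module.finrank ℝ E : ℝ) - α) ≤ (Module.finrank ℝ E : ℝ) + α) : False := by
  have hp0 : 0 < p := by linarith
  have hC := hv.C0
  have hρ0 := hv.ρ0
  have hρ1 := hv.ρ1
  have hρ' : 0 < 1 - ρ := by linarith
  obtain ⟨Λ, hΛ⟩ : ∃ Λ, Λ = 4 / (1 - ρ) := ⟨_, rfl⟩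
  have hΛ1 : 1 ≤ Λ := by rw [hΛ, le_div_iff₀ hρ']; linarith
  have hΛp : 0 < Λ := by linarith
  have hRp : ∀ k : ℕ, 0 < Λ ^ k := fun k => pow_pos hΛp k
  set d : ℝ := (Module.finrank ℝ E : ℝ) with hd
  set c := volume.real (closedBall (0:E) 2) with hc
  have hc0 : 0 ≤ c := measureReal_nonneg
  have hJ := fun k : ℕ => J_pos he hu hp0 (hRp k) hρ0 hρ1
  refine seq_contra (j := fun k => (Λ ^ k) ^ α * ∫ x in {x : E | ‖xi e (Λ ^ k) x‖ ≤ ρ}, u x ^ p)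
    (D := C * (c + 1) / ((1 - ρ) ^ α / 2)) (p := p) (fun k => mul_pos (Real.rpow_pos_of_pos (hRp k) _) (hJ k))
    (by positivity) hp fun n => ?_
  have h1 := sum_ineq hα hα1 hv he hu hp0 hΛ n
  have h2 := holder_K he hu hp (hRp n) hρ0 hρ1
  have hr := hRp n
  have hr1 : 1 ≤ Λ ^ n := one_le_pow₀ hΛ1
  have hJn := hJ n
  set r := Λ ^ n with hrd
  set J := ∫ x in {x : E | ‖xi e r x‖ ≤ ρ}, u x ^ p with hJd
  set a := (1 - ρ) ^ α / 2 with ha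
  have ha0 : 0 < a := by positivity
  have e1 : ∑ k ∈ Finset.range (n + 1), a * (Λ ^ k / r) ^ α * (∫ x in {x : E | ‖xi e (Λ ^ k) x‖ ≤ ρ}, u x ^ p)
      = a * r ^ (-α) * ∑ k ∈ Finset.range (n + 1), (Λ ^ k) ^ α * (∫ x in {x : E | ‖xi e (Λ ^ k) x‖ ≤ ρ}, u x ^ p) := by
    rw [Finset.mul_sum]
    refine Finset.sum_congr rfl fun k _ => ?_
    rw [Real.div_rpow (hRp k).le hr.le, Real.rpow_neg hr.le]
    ring
  rw [e1] at h1
  have h3 := h1.trans (mul_le_mul_of_nonneg_left h2 (by positivity))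
  set S := ∑ k ∈ Finset.range (n + 1), (Λ ^ k) ^ α * (∫ x in {x : E | ‖xi e (Λ ^ k) x‖ ≤ ρ}, u x ^ p) with hS
  have h4 : r ^ (-α) * r ^ (d * (1 - 1 / p)) ≤ r ^ (α * (1 / p)) := by
    rw [← Real.rpow_add hr]
    refine Real.rpow_le_rpow_of_exponent_le hr1 ?_
    have : (d - α) ≤ (d + α) * (1 / p) := by
      rw [mul_one_div, le_div_iff₀ hp0]; linarith
    linarith
  have e2 : r ^ (-(2 * α)) = r ^ (-α) * r ^ (-α) := by rw [← Real.rpow_add hr]; ring_nf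
  have h5 : a * S ≤ C * (c + 1) * (r ^ (α * (1 / p)) * J ^ (1 / p)) := by
    have hra : 0 < r ^ (-α) := by positivity
    refine le_of_mul_le_mul_left ?_ hra
    calc r ^ (-α) * (a * S) = a * r ^ (-α) * S := by ring
      _ ≤ _ := h3
      _ = r ^ (-α) * (C * (c + 1) * ((r ^ (-α) * r ^ (d * (1 - 1 / p))) * J ^ (1 / p))) := by rw [e2]; ring
      _ ≤ _ := by gcongr
  have e3 : (r ^ α * J) ^ (1 / p) = r ^ (α * (1 / p)) * J ^ (1 / p) := by
    rw [Real.mul_rpow (by positivity) hJn.le, ← Real.rpow_mul hr.le]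
  rw [e3, div_mul_eq_mul_div, le_div_iff₀ ha0]
  linarith
end

end

/-- Liouville theorem in the half-space for the fractional Laplacian
(Corollary 1.4): no positive supersolution of `-(-Δ)^α u + u^p ≤ 0` in the
half-space when `-1 ≤ p ≤ (N+α)/(N-α)`. -/
theorem liouville_halfspace_fractional_laplacian
    (N : ℕ) (hN : 2 ≤ N) (α p : ℝ) (hα : α ∈ Set.Ioo (0 : ℝ) 1)
    (hp₁ : -1 ≤ p) (hp₂ : p ≤ ((N : ℝ) + α) / ((N : ℝ) - α)) :
    ¬ ∃ u : EuclideanSpace ℝ (Fin N) → ℝ, Continuous u ∧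
        (∀ x : EuclideanSpace ℝ (Fin N), 0 < x ⟨N - 1, by omega⟩ → 0 < u x) ∧
        (∀ x : EuclideanSpace ℝ (Fin N), ¬ (0 < x ⟨N - 1, by omega⟩) → 0 ≤ u x) ∧
        (∀ x : EuclideanSpace ℝ (Fin N), 0 < x ⟨N - 1, by omega⟩ →
          Integrable (fun y => nlD u x y * ‖y‖ ^ (-((N : ℝ) + 2 * α))) ∧
          (∫ y, nlD u x y * ‖y‖ ^ (-((N : ℝ) + 2 * α))) + u x ^ p ≤ 0) := by
  rintro ⟨u, huc, hu1, hu2, hu3⟩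
  obtain ⟨hα0, hα1⟩ := hα
  have hfr : Module.finrank ℝ (EuclideanSpace ℝ (Fin N)) = N := finrank_euclideanSpace_fin
  have hnt : Nontrivial (EuclideanSpace ℝ (Fin N)) :=
    Module.nontrivial_of_finrank_pos (R := ℝ) (by rw [hfr]; omega)
  obtain ⟨v, ρ, C, hv⟩ := barrier_exists (E := EuclideanSpace ℝ (Fin N)) hα0 hα1
  set e : EuclideanSpace ℝ (Fin N) := EuclideanSpace.single ⟨N - 1, by omega⟩ 1 with he_def
  have he : ‖e‖ = 1 := by simp [he_def]
  have hin : ∀ x : EuclideanSpace ℝ (Fin N), inner ℝ e x = x ⟨N - 1, by omega⟩ := fun x => by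
    simp [he_def, EuclideanSpace.inner_single_left]
  have hk : ∀ y : EuclideanSpace ℝ (Fin N), kerN α y = ‖y‖ ^ (-((N : ℝ) + 2 * α)) := fun y => by
    rw [kerN, hfr]
  have hd : ∀ x y, dlt u x y = nlD u x y := fun x y => rfl
  have hu : SupSol α p e u := by
    refine ⟨huc, fun x => ?_, fun x hx => hu1 x (by rwa [hin] at hx), fun x hx => ?_, fun x hx => ?_⟩
    · by_cases hx : 0 < x ⟨N - 1, by omega⟩
      · exact (hu1 x hx).le
      · exact hu2 x hx
    · simp only [hk, hd]
      exact (hu3 x (by rwa [hin] at hx)).1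
    · simp only [hk, hd]
      exact (hu3 x (by rwa [hin] at hx)).2
  rcases lt_or_ge p 0 with h | h
  · exact case_neg hα0 hα1 hv he hu h hp₁
  rcases le_or_gt p 1 with h1 | h1
  · exact case_mid hα0 hv he hu h h1
  · refine case_big hα0 hα1 hv he hu h1 ?_
    have hN' : (2:ℝ) ≤ N := by exact_mod_cast hN
    rw [hfr]
    exact (le_div_iff₀ (by linarith)).1 hp₂
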